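/- For every N ≥ 2, θ ∈ (0, π/2], ã > 0 and d > 0 there exists a constant C > 0, depending only on N, θ, ã and d, such that the following holds: for every bounded domain Ω ⊂ ℝ^N with diameter at most d satisfying the (θ,ã)-uniform interior cone condition and every torsion function u on Ω which is C¹ up to the boundary with ∫_Ω |∇²u|² dx < ∞, setting z the barycenter of Ω, h(x) := |x−z|²/2 − u(x), ρ_e := max_{x∈∂Ω}|x−z|, ρ_i := min_{x∈∂Ω}|x−z|, B := (∫_Ω dist(x,∂Ω) |∇²h|² dx)^{1/2} and M := sup_Ω |∇h|, one has: ρ_e − ρ_i ≤ C B if N = 2; ρ_e − ρ_i ≤ C B max(log(e M / B), 1) if N = 3; and ρ_e − ρ_i ≤ C M^{(N−3)/(N−1)} B^{2/(N−1)} if N ≥ 4. -/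

import Mathlib

open MeasureTheory Metric Set Real RealInnerProductSpace

noncomputable section

/-- Euclidean space `ℝ^N`. -/
abbrev Euc (N : ℕ) : Type := EuclideanSpace ℝ (Fin N)

/-- The `(i,j)` entry of the Hessian matrix of `u` at `x`. -/
def hessEntry {N : ℕ} (u : Euc N → ℝ) (x : Euc N) (i j : Fin N) : ℝ :=
  fderiv ℝ (fun y => fderiv ℝ u y (EuclideanSpace.single j (1 : ℝ))) x
    (EuclideanSpace.single i (1 : ℝ))

/-- Squared Frobenius norm of the Hessian of `u` at `x`. -/
def hessNormSq {N : ℕ} (u : Euc N → ℝ) (x : Euc N) : ℝ :=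
  ∑ i, ∑ j, (hessEntry u x i j) ^ 2

/-- The Laplacian of `u` at `x` (trace of the Hessian). -/
def lap {N : ℕ} (u : Euc N → ℝ) (x : Euc N) : ℝ := ∑ i, hessEntry u x i i

/-- `u` is a torsion function on `Ω`: continuous on the closure, `C²` inside,
`Δu = N` in `Ω` and `u = 0` on `∂Ω`. -/
def IsTorsion {N : ℕ} (Ω : Set (Euc N)) (u : Euc N → ℝ) : Prop :=
  ContinuousOn u (closure Ω) ∧ ContDiffOn ℝ 2 u Ω ∧
    (∀ x ∈ Ω, lap u x = N) ∧ ∀ x ∈ frontier Ω, u x = 0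

/-- `G` is a `b₀`-John domain. -/
def IsJohn {N : ℕ} (b₀ : ℝ) (G : Set (Euc N)) : Prop :=
  ∀ a ∈ G, ∀ b ∈ G, a ≠ b → ∃ γ : ℝ → Euc N,
    ContinuousOn γ (Icc 0 1) ∧ γ 0 = a ∧ γ 1 = b ∧ (∀ t ∈ Icc (0:ℝ) 1, γ t ∈ G) ∧
    ∀ t ∈ Icc (0:ℝ) 1, b₀⁻¹ * min (dist (γ t) a) (dist (γ t) b) ≤ infDist (γ t) (frontier G)

/-- `(θ, a)`-uniform interior cone condition. -/
def UnifConeCond {N : ℕ} (θ a : ℝ) (G : Set (Euc N)) : Prop :=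
  ∀ x ∈ frontier G, ∃ ω : Euc N, ‖ω‖ = 1 ∧
    ∀ w ∈ ball x a ∩ closure G, ∀ y : Euc N,
      ⟪y, ω⟫ > ‖y‖ * Real.cos θ → ‖y‖ < a → w + y ∈ G

/-- `r`-uniform interior sphere condition. -/
def IntSphere {N : ℕ} (r : ℝ) (Ω : Set (Euc N)) : Prop :=
  ∀ x ∈ frontier Ω, ∃ c : Euc N, ball c r ⊆ Ω ∧ dist x c = r

/-- `r`-uniform exterior sphere condition. -/
def ExtSphere {N : ℕ} (r : ℝ) (Ω : Set (Euc N)) : Prop :=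
  ∀ x ∈ frontier Ω, ∃ c : Euc N, ball c r ⊆ (closure Ω)ᶜ ∧ dist x c = r

/-- The radial weight `(1 - ‖y‖²)₊`. -/
def radialWeight {N : ℕ} (y : Euc N) : ℝ := max (1 - ‖y‖ ^ 2) 0

lemma continuous_radialWeight {N : ℕ} : Continuous (radialWeight (N := N)) := by
  unfold radialWeight; fun_prop

lemma radialWeight_nonneg {N : ℕ} (y : Euc N) : 0 ≤ radialWeight y := le_max_right _ _

lemma radialWeight_le_one {N : ℕ} (y : Euc N) : radialWeight y ≤ 1 :=
  max_le (by nlinarith [sq_nonneg ‖y‖]) zero_le_one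

lemma radialWeight_eq_zero {N : ℕ} {y : Euc N} (hy : y ∉ closedBall (0 : Euc N) 1) :
    radialWeight y = 0 := by
  simp only [mem_closedBall, dist_zero_right, not_le] at hy
  exact max_eq_right (by nlinarith)

/-- The total mass of `radialWeight`. -/
def radialMass (N : ℕ) : ℝ := ∫ y in closedBall (0 : Euc N) 1, radialWeight y

lemma radialMass_pos (N : ℕ) : 0 < radialMass N := by
  have hc : ContinuousOn (radialWeight (N := N)) (closedBall (0 : Euc N) 1) :=
    continuous_radialWeight.continuousOn
  unfold radialMass
  rw [setIntegral_pos_iff_support_of_nonneg_ae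
    (Filter.Eventually.of_forall fun y => radialWeight_nonneg y)
    (hc.integrableOn_compact (isCompact_closedBall _ _))]
  refine lt_of_lt_of_le (measure_ball_pos volume (0 : Euc N) one_pos) (measure_mono ?_)
  intro y hy
  refine ⟨?_, ball_subset_closedBall hy⟩
  rw [mem_ball_zero_iff] at hy
  have : 0 < 1 - ‖y‖ ^ 2 := by nlinarith [norm_nonneg y]
  exact (lt_max_of_lt_left this).ne'

lemma hasDerivAt_max_zero_sq (s : ℝ) :
    HasDerivAt (fun s : ℝ => (max s 0) ^ 2) (2 * max s 0) s := by
  rcases lt_trichotomy s 0 with h | rfl | h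
  · rw [max_eq_right h.le, mul_zero]
    refine (hasDerivAt_const s (0 : ℝ)).congr_of_eventuallyEq ?_
    filter_upwards [gt_mem_nhds h] with t ht
    simp [max_eq_right ht.le]
  · rw [max_self, mul_zero, hasDerivAt_iff_isLittleO_nhds_zero]
    refine Asymptotics.IsBigO.trans_isLittleO (g := fun t : ℝ => t ^ 2) ?_ ?_
    · refine Asymptotics.IsBigO.of_bound 1 (Filter.Eventually.of_forall fun t => ?_)
      simp only [zero_add, max_self, smul_zero, sub_zero, one_mul, ne_eq, OfNat.ofNat_ne_zero,
        not_false_eq_true, zero_pow, norm_pow]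
      gcongr
      rcases le_total t 0 with ht | ht
      · simp [max_eq_right ht]
      · simp [max_eq_left ht]
    · simpa using Asymptotics.isLittleO_pow_id (𝕜 := ℝ) (n := 2) (by norm_num)
  · rw [max_eq_left h.le]
    have := hasDerivAt_pow 2 s
    simp only [Nat.cast_ofNat, Nat.add_one_sub_one, pow_one] at this
    refine this.congr_of_eventuallyEq ?_
    filter_upwards [lt_mem_nhds h] with t ht
    simp [max_eq_left ht.le]

/-- Line derivative of the radial potential of `radialWeight`. -/
lemma hasLineDerivAt_radialWeight_sq {N : ℕ} (y v : Euc N) :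
    HasLineDerivAt ℝ (fun y : Euc N => -(radialWeight y) ^ 2 / 4)
      (radialWeight y * ⟪y, v⟫) y v := by
  have h1 : HasDerivAt (fun t : ℝ => y + t • v) v 0 := by
    simpa using ((hasDerivAt_id (0 : ℝ)).smul_const v).const_add y
  have h2 := (h1.norm_sq.const_sub 1)
  have h3 := ((hasDerivAt_max_zero_sq (1 - ‖y + (0 : ℝ) • v‖ ^ 2)).comp (0 : ℝ) h2)
  have h4 := (h3.neg.div_const 4)
  refine HasDerivAt.congr_deriv (f' := _) h4 ?_
  simp only [zero_smul, add_zero, radialWeight]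
  ring

/-- The average of `f` over the ball of centre `x` and radius `r`, weighted by `radialWeight`
(without normalisation). -/
def radialAverage {N : ℕ} (f : Euc N → ℝ) (x : Euc N) (r : ℝ) : ℝ :=
  ∫ y in closedBall (0 : Euc N) 1, radialWeight y * f (x + r • y)

lemma add_smul_mem_of_closedBall_subset {N : ℕ} {Ω : Set (Euc N)} {x : Euc N} {r : ℝ}
    (hr : closedBall x |r| ⊆ Ω) {y : Euc N} (hy : y ∈ closedBall (0 : Euc N) 1) :
    x + r • y ∈ Ω := by
  refine hr ?_
  rw [mem_closedBall_zero_iff] at hy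
  rw [mem_closedBall, dist_self_add_left, norm_smul, Real.norm_eq_abs]
  exact mul_le_of_le_one_right (abs_nonneg r) hy

lemma continuousOn_radialWeight_mul {N : ℕ} {Ω : Set (Euc N)} {f : Euc N → ℝ}
    (hf : ContinuousOn f Ω) {x : Euc N} {r : ℝ} (hr : closedBall x |r| ⊆ Ω) :
    ContinuousOn (fun y => radialWeight y * f (x + r • y)) (closedBall (0 : Euc N) 1) := by
  refine continuous_radialWeight.continuousOn.mul (hf.comp (by fun_prop) ?_)
  exact fun y hy => add_smul_mem_of_closedBall_subset hr hy

/-- Differentiation of weighted averages along an affine motion of centre and radius. -/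
lemma hasDerivAt_radialAverage {N : ℕ} {Ω : Set (Euc N)} (hΩ : IsOpen Ω) {f : Euc N → ℝ}
    (hf : ContDiffOn ℝ 1 f Ω) (x v : Euc N) (r m : ℝ) (hr : closedBall x |r| ⊆ Ω) :
    HasDerivAt (fun t : ℝ => radialAverage f (x + t • v) (r + t * m))
      (∫ y in closedBall (0 : Euc N) 1, radialWeight y * fderiv ℝ f (x + r • y) (v + m • y)) 0 := by
  obtain ⟨δ, hδ, hsub⟩ := (isCompact_closedBall x |r|).exists_cthickening_subset_open hΩ hr
  have hK : IsCompact (cthickening δ (closedBall x |r|)) := (isCompact_closedBall x |r|).cthickening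
  have hfd : ContinuousOn (fderiv ℝ f) Ω := hf.continuousOn_fderiv_of_isOpen hΩ le_rfl
  obtain ⟨C, hC⟩ := hK.exists_bound_of_continuousOn (hfd.mono hsub)
  set ε : ℝ := δ / (‖v‖ + |m| + 1) with hε
  have hε0 : 0 < ε := by positivity
  have hpt : ∀ t ∈ ball (0 : ℝ) ε, ∀ y ∈ closedBall (0 : Euc N) 1,
      x + t • v + (r + t * m) • y ∈ cthickening δ (closedBall x |r|) := by
    intro t ht y hy
    rw [mem_ball_zero_iff, Real.norm_eq_abs] at ht
    refine mem_cthickening_of_dist_le _ (x + r • y) _ _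
      (add_smul_mem_of_closedBall_subset subset_rfl hy) ?_
    rw [mem_closedBall_zero_iff] at hy
    have : x + t • v + (r + t * m) • y - (x + r • y) = t • (v + m • y) := by
      module
    rw [dist_eq_norm, this, norm_smul, Real.norm_eq_abs]
    have h1 : ‖v + m • y‖ ≤ ‖v‖ + |m| + 1 := by
      refine (norm_add_le _ _).trans ?_
      rw [norm_smul, Real.norm_eq_abs]
      nlinarith [abs_nonneg m]
    calc |t| * ‖v + m • y‖ ≤ ε * (‖v‖ + |m| + 1) := by gcongr
      _ = δ := by rw [hε]; field_simp
  have hcont : ∀ t ∈ ball (0 : ℝ) ε, ContinuousOn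
      (fun y => radialWeight y * f (x + t • v + (r + t * m) • y)) (closedBall (0 : Euc N) 1) := by
    intro t ht
    refine continuous_radialWeight.continuousOn.mul (hf.continuousOn.comp (by fun_prop) ?_)
    exact fun y hy => hsub (hpt t ht y hy)
  have h0 : (0 : ℝ) ∈ ball (0 : ℝ) ε := mem_ball_self hε0
  have key := hasDerivAt_integral_of_dominated_loc_of_deriv_le
    (μ := volume.restrict (closedBall (0 : Euc N) 1)) (x₀ := (0 : ℝ)) (s := ball (0 : ℝ) ε)
    (F := fun t y => radialWeight y * f (x + t • v + (r + t * m) • y))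
    (F' := fun t y => radialWeight y *
      fderiv ℝ f (x + t • v + (r + t * m) • y) (v + m • y))
    (bound := fun _ => C * (‖v‖ + |m| + 1)) (ball_mem_nhds _ hε0) ?_ ?_ ?_ ?_ ?_ ?_
  · refine HasDerivAt.congr_deriv (f' := _) key.2 ?_
    simp only [zero_smul, add_zero, zero_mul]
  · filter_upwards [ball_mem_nhds (0 : ℝ) hε0] with t ht
    exact (hcont t ht).aestronglyMeasurable measurableSet_closedBall
  · exact (hcont 0 h0).integrableOn_compact (isCompact_closedBall _ _)
  · refine ContinuousOn.aestronglyMeasurable ?_ measurableSet_closedBall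
    refine continuous_radialWeight.continuousOn.mul (ContinuousOn.clm_apply
      (hfd.comp (by fun_prop) fun y hy => hsub (hpt 0 h0 y hy)) (by fun_prop))
  · filter_upwards [ae_restrict_mem measurableSet_closedBall] with y hy t ht
    have h1 := hC _ (hpt t ht y hy)
    rw [mem_closedBall_zero_iff] at hy
    have h2 : ‖v + m • y‖ ≤ ‖v‖ + |m| + 1 := by
      refine (norm_add_le _ _).trans ?_
      rw [norm_smul, Real.norm_eq_abs]
      nlinarith [abs_nonneg m]
    rw [norm_mul, Real.norm_of_nonneg (radialWeight_nonneg y)]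
    calc radialWeight y * ‖fderiv ℝ f (x + t • v + (r + t * m) • y) (v + m • y)‖
        ≤ 1 * (‖fderiv ℝ f (x + t • v + (r + t * m) • y)‖ * ‖v + m • y‖) := by
          gcongr
          · exact radialWeight_le_one y
          · exact ContinuousLinearMap.le_opNorm _ _
      _ ≤ C * (‖v‖ + |m| + 1) := by
          rw [one_mul]
          have := (norm_nonneg _).trans h1
          gcongr
  · exact integrableOn_const (isCompact_closedBall _ _).measure_lt_top.ne
  · filter_upwards [ae_restrict_mem measurableSet_closedBall] with y hy t ht
    have hd : DifferentiableAt ℝ f (x + t • v + (r + t * m) • y) :=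
      (hf.differentiableOn one_ne_zero).differentiableAt (hΩ.mem_nhds (hsub (hpt t ht y hy)))
    have hγ : HasDerivAt (fun t : ℝ => x + t • v + (r + t * m) • y) (v + m • y) t := by
      have a1 := ((hasDerivAt_id t).smul_const v).const_add x
      have a2 := (((hasDerivAt_id t).mul_const m).const_add r).smul_const y
      refine HasDerivAt.congr_deriv (f' := _) (a1.add a2) ?_
      simp
    exact (hd.hasFDerivAt.comp_hasDerivAt t hγ).const_mul _

/-- The partial derivative of `f` in direction `v`, as a function. -/
def dirDeriv {N : ℕ} (v : Euc N) (f : Euc N → ℝ) (x : Euc N) : ℝ := fderiv ℝ f x v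

lemma hessEntry_eq_dirDeriv {N : ℕ} (f : Euc N → ℝ) (x : Euc N) (i j : Fin N) :
    hessEntry f x i j = dirDeriv (EuclideanSpace.single i 1)
      (dirDeriv (EuclideanSpace.single j 1) f) x := rfl

lemma contDiffOn_dirDeriv {N : ℕ} {Ω : Set (Euc N)} (hΩ : IsOpen Ω) {f : Euc N → ℝ} {n : ℕ}
    (hf : ContDiffOn ℝ (n + 1) f Ω) (v : Euc N) : ContDiffOn ℝ n (dirDeriv v f) Ω :=
  (hf.fderiv_of_isOpen hΩ le_rfl).clm_apply contDiffOn_const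

lemma euc_eq_sum_single {N : ℕ} (v : Euc N) :
    v = ∑ i, v i • EuclideanSpace.single i (1 : ℝ) := by
  simpa using ((EuclideanSpace.basisFun (Fin N) ℝ).sum_repr v).symm

lemma clm_apply_eq_sum_single {N : ℕ} (L : Euc N →L[ℝ] ℝ) (v : Euc N) :
    L v = ∑ i, v i * L (EuclideanSpace.single i 1) := by
  conv_lhs => rw [euc_eq_sum_single v]
  simp [map_sum]

/-- Integration by parts of one partial derivative against the potential of `radialWeight`. -/
lemma integral_radialWeight_coord_mul {N : ℕ} {Ω : Set (Euc N)} (hΩ : IsOpen Ω) {g : Euc N → ℝ}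
    (hg : ContDiffOn ℝ 1 g Ω) {x : Euc N} {t : ℝ} (ht : closedBall x |t| ⊆ Ω) (v : Euc N) :
    ∫ y in closedBall (0 : Euc N) 1, radialWeight y * (⟪y, v⟫ * g (x + t • y)) =
      t / 4 * ∫ y in closedBall (0 : Euc N) 1,
        radialWeight y ^ 2 * dirDeriv v g (x + t • y) := by
  have hmem : ∀ y ∈ closedBall (0 : Euc N) 1, x + t • y ∈ Ω :=
    fun y hy => add_smul_mem_of_closedBall_subset ht hy
  have hP : Continuous (fun y : Euc N => -(radialWeight y) ^ 2 / 4) := by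
    have := continuous_radialWeight (N := N); fun_prop
  have hgc : ContinuousOn (fun y => g (x + t • y)) (closedBall (0 : Euc N) 1) :=
    hg.continuousOn.comp (by fun_prop) hmem
  have hdc : ContinuousOn (fun y => fderiv ℝ g (x + t • y) (t • v)) (closedBall (0 : Euc N) 1) :=
    ((hg.continuousOn_fderiv_of_isOpen hΩ le_rfl).comp (by fun_prop) hmem).clm_apply
      continuousOn_const
  have hsupp : tsupport (fun y : Euc N => -(radialWeight y) ^ 2 / 4) ⊆
      closedBall (0 : Euc N) 1 := by
    refine closure_minimal ?_ isClosed_closedBall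
    intro y hy
    by_contra hn
    exact hy (by simp [radialWeight_eq_zero hn])
  have hint : ∀ F : Euc N → ℝ, ContinuousOn F (closedBall (0 : Euc N) 1) →
      (∀ y ∉ closedBall (0 : Euc N) 1, F y = 0) → Integrable F := by
    intro F hF h0
    rw [← integrableOn_iff_integrable_of_support_subset (s := closedBall (0 : Euc N) 1)]
    · exact hF.integrableOn_compact (isCompact_closedBall _ _)
    · intro y hy
      by_contra hn
      exact hy (h0 y hn)
  have key := integral_bilinear_hasLineDerivAt_right_eq_neg_left_of_integrable
    (μ := (volume : Measure (Euc N)))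
    (f := fun y : Euc N => -(radialWeight y) ^ 2 / 4)
    (f' := fun y : Euc N => radialWeight y * ⟪y, v⟫)
    (g := fun y => g (x + t • y)) (g' := fun y => fderiv ℝ g (x + t • y) (t • v)) (v := v)
    (B := ContinuousLinearMap.mul ℝ ℝ) ?_ ?_ ?_ ?_ ?_
  · simp only [ContinuousLinearMap.mul_apply'] at key
    have e1 : ∫ y : Euc N, radialWeight y * ⟪y, v⟫ * g (x + t • y) =
        ∫ y in closedBall (0 : Euc N) 1, radialWeight y * (⟪y, v⟫ * g (x + t • y)) := by
      rw [setIntegral_eq_integral_of_forall_compl_eq_zero]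
      · simp only [mul_assoc]
      · intro y hy; simp [radialWeight_eq_zero hy]
    have e2 : ∫ y : Euc N, -(radialWeight y) ^ 2 / 4 * fderiv ℝ g (x + t • y) (t • v) =
        ∫ y in closedBall (0 : Euc N) 1,
          -(radialWeight y) ^ 2 / 4 * fderiv ℝ g (x + t • y) (t • v) := by
      rw [setIntegral_eq_integral_of_forall_compl_eq_zero]
      intro y hy; simp [radialWeight_eq_zero hy]
    rw [e1, e2] at key
    rw [← neg_eq_iff_eq_neg.mpr key, ← integral_neg, ← integral_const_mul]
    refine integral_congr_ae (Filter.Eventually.of_forall fun y => ?_)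
    simp only [map_smul, smul_eq_mul, dirDeriv]
    ring
  · refine hint _ ?_ fun y hy => by simp [radialWeight_eq_zero hy]
    simp only [ContinuousLinearMap.mul_apply']
    exact (continuous_radialWeight.continuousOn.mul (by fun_prop)).mul hgc
  · refine hint _ ?_ fun y hy => by simp [radialWeight_eq_zero hy]
    simp only [ContinuousLinearMap.mul_apply']
    exact hP.continuousOn.mul hdc
  · refine hint _ ?_ fun y hy => by simp [radialWeight_eq_zero hy]
    simp only [ContinuousLinearMap.mul_apply']
    exact hP.continuousOn.mul hgc
  · intro y _
    exact hasLineDerivAt_radialWeight_sq y v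
  · intro y hy
    have hd : DifferentiableAt ℝ g (x + t • y) :=
      (hg.differentiableOn one_ne_zero).differentiableAt (hΩ.mem_nhds (hmem y (hsupp hy)))
    have h1 : HasDerivAt (fun s : ℝ => x + t • (y + s • v)) (t • v) 0 := by
      have a := ((((hasDerivAt_id (0 : ℝ)).smul_const v).const_add y).const_smul t).const_add x
      refine HasDerivAt.congr_deriv (f' := _) a ?_
      simp
    have hd' : DifferentiableAt ℝ g (x + t • (y + (0 : ℝ) • v)) := by simpa using hd
    have h2 := hd'.hasFDerivAt.comp_hasDerivAt (0 : ℝ) h1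
    simp only [zero_smul, add_zero] at h2
    exact h2

/-- The radial derivative of a harmonic function has vanishing weighted average. -/
lemma integral_radialWeight_radial_fderiv {N : ℕ} {Ω : Set (Euc N)} (hΩ : IsOpen Ω)
    {f : Euc N → ℝ} (hf : ContDiffOn ℝ 2 f Ω) (hlap : ∀ x ∈ Ω, lap f x = 0) {x : Euc N} {t : ℝ}
    (ht : closedBall x |t| ⊆ Ω) :
    ∫ y in closedBall (0 : Euc N) 1, radialWeight y * fderiv ℝ f (x + t • y) y = 0 := by
  have hmem : ∀ y ∈ closedBall (0 : Euc N) 1, x + t • y ∈ Ω :=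
    fun y hy => add_smul_mem_of_closedBall_subset ht hy
  have hd1 : ∀ i : Fin N, ContDiffOn ℝ 1 (dirDeriv (EuclideanSpace.single i 1) f) Ω :=
    fun i => contDiffOn_dirDeriv (n := 1) hΩ (by norm_num; exact hf) _
  have hd2 : ∀ i : Fin N, ContinuousOn (dirDeriv (EuclideanSpace.single i 1)
      (dirDeriv (EuclideanSpace.single i 1) f)) Ω :=
    fun i => (contDiffOn_dirDeriv (n := 0) hΩ (by simpa using hd1 i) _).continuousOn
  have e1 : ∀ y : Euc N, radialWeight y * fderiv ℝ f (x + t • y) y =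
      ∑ i, radialWeight y * (⟪y, EuclideanSpace.single i (1 : ℝ)⟫ *
        dirDeriv (EuclideanSpace.single i 1) f (x + t • y)) := by
    intro y
    rw [clm_apply_eq_sum_single, Finset.mul_sum]
    simp [dirDeriv, EuclideanSpace.inner_single_right]
  simp only [e1]
  rw [integral_finsetSum]
  · simp only [fun i => integral_radialWeight_coord_mul hΩ (hd1 i) ht (EuclideanSpace.single i 1)]
    rw [← Finset.mul_sum, ← integral_finsetSum]
    · rw [setIntegral_congr_fun measurableSet_closedBall (g := fun _ => (0 : ℝ))]
      · simp
      · intro y hy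
        have h := hlap _ (hmem y hy)
        simp only [lap, hessEntry_eq_dirDeriv] at h
        simp only [← Finset.mul_sum, h, mul_zero]
    · intro i _
      refine ContinuousOn.integrableOn_compact (isCompact_closedBall _ _) ?_
      exact (continuous_radialWeight.pow 2).continuousOn.mul
        ((hd2 i).comp (by fun_prop) hmem)
  · intro i _
    refine ContinuousOn.integrableOn_compact (isCompact_closedBall _ _) ?_
    exact continuous_radialWeight.continuousOn.mul
      (ContinuousOn.mul (f := fun y : Euc N => ⟪y, EuclideanSpace.single i (1 : ℝ)⟫)
        (by fun_prop) ((hd1 i).continuousOn.comp (by fun_prop) hmem))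

/-- Mean value property with weight `radialWeight`. -/
lemma radialAverage_eq_of_harmonic {N : ℕ} {Ω : Set (Euc N)} (hΩ : IsOpen Ω)
    {f : Euc N → ℝ} (hf : ContDiffOn ℝ 2 f Ω) (hlap : ∀ x ∈ Ω, lap f x = 0) {x : Euc N} {r : ℝ}
    (hr0 : 0 ≤ r) (hr : closedBall x r ⊆ Ω) :
    radialAverage f x r = radialMass N * f x := by
  have hder : ∀ t ∈ Icc 0 r, HasDerivAt (fun s => radialAverage f x s) 0 t := by
    intro t ht
    have hsub : closedBall x |t| ⊆ Ω := by
      rw [abs_of_nonneg ht.1]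
      exact (closedBall_subset_closedBall ht.2).trans hr
    have h1 := hasDerivAt_radialAverage hΩ (hf.of_le one_le_two) x 0 t 1 hsub
    simp only [smul_zero, add_zero, mul_one, zero_add, one_smul,
      integral_radialWeight_radial_fderiv hΩ hf hlap hsub] at h1
    have h2 := HasDerivAt.comp_sub_const (f := fun s => radialAverage f x (t + s)) (x := t)
      (a := t) (f' := 0) (by simpa using h1)
    simpa using h2
  have := constant_of_has_deriv_right_zero (f := fun s => radialAverage f x s)
    (fun t ht => (hder t ht).continuousAt.continuousWithinAt)
    (fun t ht => (hder t (Ico_subset_Icc_self ht)).hasDerivWithinAt) r ⟨hr0, le_rfl⟩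
  rw [this]
  simp only [radialAverage, zero_smul, add_zero, radialMass, integral_mul_const]

/-- The mean value property passes to derivatives. -/
lemma radialAverage_dirDeriv {N : ℕ} {Ω : Set (Euc N)} (hΩ : IsOpen Ω)
    {f : Euc N → ℝ} (hf : ContDiffOn ℝ 1 f Ω) {r : ℝ} (hr0 : 0 ≤ r)
    (hmean : ∀ x, closedBall x r ⊆ Ω → radialAverage f x r = radialMass N * f x)
    (v : Euc N) {x : Euc N} (hr : closedBall x r ⊆ Ω) :
    radialAverage (dirDeriv v f) x r = radialMass N * dirDeriv v f x := by
  have h1 := hasDerivAt_radialAverage hΩ hf x v r 0 (by rwa [abs_of_nonneg hr0])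
  simp only [mul_zero, add_zero, zero_smul] at h1
  have hx : x ∈ Ω := hr (mem_closedBall_self hr0)
  have hd : DifferentiableAt ℝ f x :=
    (hf.differentiableOn one_ne_zero).differentiableAt (hΩ.mem_nhds hx)
  have hγ : HasDerivAt (fun t : ℝ => x + t • v) v 0 := by
    refine HasDerivAt.congr_deriv (f' := _) (((hasDerivAt_id (0 : ℝ)).smul_const v).const_add x) ?_
    simp
  have hd' : DifferentiableAt ℝ f (x + (0 : ℝ) • v) := by simpa using hd
  have h2 := (hd'.hasFDerivAt.comp_hasDerivAt (0 : ℝ) hγ).const_mul (radialMass N)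
  simp only [zero_smul, add_zero] at h2
  obtain ⟨δ, hδ, hsub⟩ := (isCompact_closedBall x r).exists_cthickening_subset_open hΩ hr
  have hev : (fun t : ℝ => radialAverage f (x + t • v) r) =ᶠ[nhds 0]
      fun t => radialMass N * f (x + t • v) := by
    have hc : Filter.Tendsto (fun t : ℝ => x + t • v) (nhds 0) (nhds x) := by
      have : Continuous (fun t : ℝ => x + t • v) := by fun_prop
      simpa using this.tendsto 0
    filter_upwards [hc (ball_mem_nhds x hδ)] with t ht
    refine hmean _ fun y hy => hsub ?_
    rw [cthickening_closedBall hδ.le hr0, mem_closedBall]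
    have := dist_triangle y (x + t • v) x
    rw [mem_closedBall] at hy
    have ht' : dist (x + t • v) x < δ := ht
    linarith
  exact h1.unique (h2.congr_of_eventuallyEq hev)

lemma radialAverage_hessEntry {N : ℕ} {Ω : Set (Euc N)} (hΩ : IsOpen Ω)
    {f : Euc N → ℝ} (hf : ContDiffOn ℝ 2 f Ω) (hlap : ∀ x ∈ Ω, lap f x = 0) {x : Euc N} {r : ℝ}
    (hr0 : 0 ≤ r) (hr : closedBall x r ⊆ Ω) (i j : Fin N) :
    radialAverage (fun y => hessEntry f y i j) x r = radialMass N * hessEntry f x i j :=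
  radialAverage_dirDeriv hΩ (contDiffOn_dirDeriv (n := 1) hΩ (by norm_num; exact hf) _) hr0
    (fun _ hy => radialAverage_dirDeriv hΩ (hf.of_le one_le_two) hr0
      (fun _ hy' => radialAverage_eq_of_harmonic hΩ hf hlap hr0 hy') _ hy) _ hr

lemma continuousOn_hessEntry {N : ℕ} {Ω : Set (Euc N)} (hΩ : IsOpen Ω)
    {f : Euc N → ℝ} (hf : ContDiffOn ℝ 2 f Ω) (i j : Fin N) :
    ContinuousOn (fun y => hessEntry f y i j) Ω :=
  have h1 : ContDiffOn ℝ 1 (dirDeriv (EuclideanSpace.single j 1) f) Ω :=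
    contDiffOn_dirDeriv (n := 1) hΩ (by norm_num; exact hf) _
  (contDiffOn_dirDeriv (n := 0) (f := dirDeriv (EuclideanSpace.single j 1) f) hΩ
    (by simpa using h1) _).continuousOn

lemma continuousOn_hessNormSq {N : ℕ} {Ω : Set (Euc N)} (hΩ : IsOpen Ω)
    {f : Euc N → ℝ} (hf : ContDiffOn ℝ 2 f Ω) : ContinuousOn (hessNormSq f) Ω :=
  continuousOn_finsetSum _ fun i _ => continuousOn_finsetSum _ fun j _ =>
    (continuousOn_hessEntry hΩ hf i j).pow 2

lemma hessNormSq_nonneg {N : ℕ} (f : Euc N → ℝ) (x : Euc N) : 0 ≤ hessNormSq f x :=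
  Finset.sum_nonneg fun _ _ => Finset.sum_nonneg fun _ _ => sq_nonneg _

lemma hessEntry_sq_le {N : ℕ} (f : Euc N → ℝ) (x : Euc N) (i j : Fin N) :
    hessEntry f x i j ^ 2 ≤ hessNormSq f x :=
  (Finset.single_le_sum (f := fun j => hessEntry f x i j ^ 2) (fun _ _ => sq_nonneg _)
    (Finset.mem_univ j)).trans
    (Finset.single_le_sum (f := fun i => ∑ j, hessEntry f x i j ^ 2)
      (fun _ _ => Finset.sum_nonneg fun _ _ => sq_nonneg _) (Finset.mem_univ i))

/-- The squared weighted mean value is at most the plain average of the square. -/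
lemma radialMass_mul_sq_le {N : ℕ} {Ω : Set (Euc N)} {F : Euc N → ℝ} (hF : ContinuousOn F Ω)
    {x : Euc N} {r : ℝ} (hr0 : 0 < r) (hr : closedBall x r ⊆ Ω)
    (hmean : radialAverage F x r = radialMass N * F x) :
    radialMass N * F x ^ 2 ≤ (r ^ N)⁻¹ * ∫ y in closedBall x r, F y ^ 2 := by
  have hr' : closedBall x |r| ⊆ Ω := by rwa [abs_of_pos hr0]
  have hc : IsCompact (closedBall (0 : Euc N) 1) := isCompact_closedBall _ _
  have hw : IntegrableOn (radialWeight (N := N)) (closedBall (0 : Euc N) 1) :=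
    continuous_radialWeight.continuousOn.integrableOn_compact hc
  have hi1 : IntegrableOn (fun y => radialWeight y * F (x + r • y)) (closedBall (0 : Euc N) 1) :=
    (continuousOn_radialWeight_mul hF hr').integrableOn_compact hc
  have hi2 : IntegrableOn (fun y => radialWeight y * F (x + r • y) ^ 2)
      (closedBall (0 : Euc N) 1) :=
    (continuousOn_radialWeight_mul (hF.pow 2) hr').integrableOn_compact hc
  have hi3 : IntegrableOn (fun y => F (x + r • y) ^ 2) (closedBall (0 : Euc N) 1) :=
    (((hF.comp (f := fun y : Euc N => x + r • y) (by fun_prop)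
      fun y hy => add_smul_mem_of_closedBall_subset hr' hy).pow 2)).integrableOn_compact hc
  have h1 : radialMass N * F x ^ 2 ≤
      ∫ y in closedBall (0 : Euc N) 1, radialWeight y * F (x + r • y) ^ 2 := by
    have h0 : 0 ≤ ∫ y in closedBall (0 : Euc N) 1, radialWeight y * (F (x + r • y) - F x) ^ 2 :=
      integral_nonneg fun y => mul_nonneg (radialWeight_nonneg y) (sq_nonneg _)
    have e : ∫ y in closedBall (0 : Euc N) 1, radialWeight y * (F (x + r • y) - F x) ^ 2 =
        (∫ y in closedBall (0 : Euc N) 1, radialWeight y * F (x + r • y) ^ 2)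
        - 2 * F x * (∫ y in closedBall (0 : Euc N) 1, radialWeight y * F (x + r • y))
        + F x ^ 2 * radialMass N := by
      rw [radialMass, ← integral_const_mul, ← integral_const_mul, ← integral_sub,
        ← integral_add]
      · refine integral_congr_ae (Filter.Eventually.of_forall fun y => ?_)
        ring
      · exact hi2.sub (hi1.const_mul _)
      · exact hw.const_mul _
      · exact hi2
      · exact hi1.const_mul _
    have hm : (∫ y in closedBall (0 : Euc N) 1, radialWeight y * F (x + r • y)) =
      radialMass N * F x := hmean
    rw [e, hm] at h0
    nlinarith
  refine h1.trans ?_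
  have h2 : ∫ y in closedBall (0 : Euc N) 1, radialWeight y * F (x + r • y) ^ 2 ≤
      ∫ y in closedBall (0 : Euc N) 1, F (x + r • y) ^ 2 :=
    integral_mono hi2 hi3 fun y =>
      mul_le_of_le_one_left (sq_nonneg _) (radialWeight_le_one y)
  refine h2.trans (le_of_eq ?_)
  have h3 := Measure.setIntegral_comp_smul_of_pos (volume : Measure (Euc N))
    (fun y => F (x + y) ^ 2) (closedBall (0 : Euc N) 1) hr0
  rw [h3, finrank_euclideanSpace_fin, smul_eq_mul, smul_unitClosedBall_of_nonneg hr0.le]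
  congr 1
  have h4 := (measurePreserving_add_left (volume : Measure (Euc N)) x).setIntegral_preimage_emb
    (measurableEmbedding_addLeft x) (fun y => F y ^ 2) (closedBall x r)
  rw [← h4]
  congr 2
  ext y
  simp [mem_closedBall, dist_eq_norm]

/-- A ball inside `Ω` gives a lower bound for the distance to the boundary. -/
lemma le_infDist_frontier {N : ℕ} {Ω : Set (Euc N)} (hΩ : IsOpen Ω)
    (hne : (frontier Ω).Nonempty) {x y : Euc N} {r s : ℝ} (hx : ball x s ⊆ Ω)
    (hy : dist y x ≤ s - r) : r ≤ infDist y (frontier Ω) := by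
  refine (le_infDist hne).2 fun w hw => ?_
  by_contra! hlt
  have : w ∈ ball x s := by
    have := dist_triangle w y x
    rw [dist_comm w y] at this
    rw [mem_ball]; linarith
  have hd := hΩ.inter_frontier_eq
  exact (hd.subset ⟨hx this, hw⟩ : w ∈ (∅ : Set (Euc N)))

/-- Interior estimate for the Hessian of a harmonic function by the weighted `L²` norm. -/
lemma hessEntry_sq_mul_le {N : ℕ} {Ω : Set (Euc N)} (hΩ : IsOpen Ω)
    (hne : (frontier Ω).Nonempty) {f : Euc N → ℝ} (hf : ContDiffOn ℝ 2 f Ω)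
    (hlap : ∀ x ∈ Ω, lap f x = 0)
    (hint : IntegrableOn (fun x => infDist x (frontier Ω) * hessNormSq f x) Ω)
    {x : Euc N} {r : ℝ} (hr0 : 0 < r) (hr : ball x (2 * r) ⊆ Ω) (i j : Fin N) :
    radialMass N * r ^ (N + 1) * hessEntry f x i j ^ 2 ≤
      ∫ x in Ω, infDist x (frontier Ω) * hessNormSq f x := by
  have hcb : closedBall x r ⊆ Ω := (closedBall_subset_ball (by linarith)).trans hr
  have h1 := radialMass_mul_sq_le (continuousOn_hessEntry hΩ hf i j) hr0 hcb
    (radialAverage_hessEntry hΩ hf hlap hr0.le hcb i j)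
  have h2 : r * ∫ y in closedBall x r, hessEntry f y i j ^ 2 ≤
      ∫ y in closedBall x r, infDist y (frontier Ω) * hessNormSq f y := by
    rw [← integral_const_mul]
    refine setIntegral_mono_on ?_ (hint.mono_set hcb) measurableSet_closedBall ?_
    · exact ContinuousOn.integrableOn_compact (isCompact_closedBall _ _)
        (continuousOn_const.mul (((continuousOn_hessEntry hΩ hf i j).mono hcb).pow 2))
    · intro y hy
      have : r ≤ infDist y (frontier Ω) :=
        le_infDist_frontier hΩ hne hr (by rw [mem_closedBall] at hy; linarith)
      exact mul_le_mul this (hessEntry_sq_le f y i j) (sq_nonneg _) infDist_nonneg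
  have h3 : ∫ y in closedBall x r, infDist y (frontier Ω) * hessNormSq f y ≤
      ∫ x in Ω, infDist x (frontier Ω) * hessNormSq f x :=
    setIntegral_mono_set hint
      (Filter.Eventually.of_forall fun y => mul_nonneg infDist_nonneg (hessNormSq_nonneg f y))
      (LE.le.eventuallyLE hcb)
  calc radialMass N * r ^ (N + 1) * hessEntry f x i j ^ 2
      = r ^ (N + 1) * (radialMass N * hessEntry f x i j ^ 2) := by ring
    _ ≤ r ^ (N + 1) * ((r ^ N)⁻¹ * ∫ y in closedBall x r, hessEntry f y i j ^ 2) := by gcongr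
    _ = r * ∫ y in closedBall x r, hessEntry f y i j ^ 2 := by
        rw [pow_succ]; field_simp
    _ ≤ _ := h2.trans h3

lemma dirDeriv_eq_sum {N : ℕ} (v : Euc N) (f : Euc N → ℝ) :
    dirDeriv v f = ∑ j, v j • dirDeriv (EuclideanSpace.single j 1) f := by
  ext x
  simp [dirDeriv, clm_apply_eq_sum_single (fderiv ℝ f x) v]

lemma dirDeriv_dirDeriv_eq_sum {N : ℕ} {Ω : Set (Euc N)} (hΩ : IsOpen Ω) {f : Euc N → ℝ}
    (hf : ContDiffOn ℝ 2 f Ω) (v w : Euc N) {x : Euc N} (hx : x ∈ Ω) :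
    dirDeriv w (dirDeriv v f) x = ∑ i, ∑ j, w i * (v j * hessEntry f x i j) := by
  have hd : ∀ j : Fin N, DifferentiableAt ℝ (dirDeriv (EuclideanSpace.single j 1) f) x :=
    fun j => ((contDiffOn_dirDeriv (n := 1) hΩ (by norm_num; exact hf) _).differentiableOn
      one_ne_zero).differentiableAt (hΩ.mem_nhds hx)
  rw [dirDeriv_eq_sum w]
  simp only [Finset.sum_apply, Pi.smul_apply, smul_eq_mul]
  refine Finset.sum_congr rfl fun i _ => ?_
  rw [← Finset.mul_sum]
  congr 1
  rw [dirDeriv_eq_sum v, dirDeriv, fderiv_sum fun j _ => (hd j).const_smul (v j)]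
  simp only [fderiv_const_smul (hd _), sum_apply, smul_apply, smul_eq_mul]
  rfl

lemma abs_dirDeriv_dirDeriv_le {N : ℕ} {Ω : Set (Euc N)} (hΩ : IsOpen Ω) {f : Euc N → ℝ}
    (hf : ContDiffOn ℝ 2 f Ω) {v w : Euc N} {x : Euc N} (hx : x ∈ Ω) {E : ℝ}
    (hE : ∀ i j, |hessEntry f x i j| ≤ E) :
    |dirDeriv w (dirDeriv v f) x| ≤ N ^ 2 * E * ‖v‖ * ‖w‖ := by
  rw [dirDeriv_dirDeriv_eq_sum hΩ hf v w hx]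
  refine (Finset.abs_sum_le_sum_abs _ _).trans ?_
  have : ∀ i ∈ Finset.univ (α := Fin N), |∑ j, w i * (v j * hessEntry f x i j)| ≤
      N * (‖w‖ * (‖v‖ * E)) := by
    intro i _
    refine (Finset.abs_sum_le_sum_abs _ _).trans ?_
    refine (Finset.sum_le_card_nsmul _ _ (‖w‖ * (‖v‖ * E)) ?_).trans (by simp)
    intro j _
    rw [abs_mul, abs_mul]
    have h1 : |w i| ≤ ‖w‖ := PiLp.norm_apply_le w i
    have h2 : |v j| ≤ ‖v‖ := PiLp.norm_apply_le v j
    gcongr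
    exact hE i j
  refine (Finset.sum_le_card_nsmul _ _ _ this).trans (le_of_eq ?_)
  simp only [Finset.card_univ, Fintype.card_fin, nsmul_eq_mul]
  ring

/-- Pointwise bound of second derivatives by the weighted `L²` norm `B` of the Hessian. -/
lemma exists_hess_bound (N : ℕ) : ∃ A > (0 : ℝ), ∀ {Ω : Set (Euc N)}, IsOpen Ω →
    (frontier Ω).Nonempty → ∀ {f : Euc N → ℝ}, ContDiffOn ℝ 2 f Ω → (∀ x ∈ Ω, lap f x = 0) →
    IntegrableOn (fun x => infDist x (frontier Ω) * hessNormSq f x) Ω →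
    ∀ {B : ℝ}, B = Real.sqrt (∫ x in Ω, infDist x (frontier Ω) * hessNormSq f x) →
    ∀ {x : Euc N} {r : ℝ}, 0 < r → ball x r ⊆ Ω → ∀ v w : Euc N,
      |dirDeriv w (dirDeriv v f) x| ≤ A * B * r ^ (-((N : ℝ) + 1) / 2) * ‖v‖ * ‖w‖ := by
  have hm := radialMass_pos N
  refine ⟨(N ^ 2 + 1) * (2 ^ (((N : ℝ) + 1) / 2) * (Real.sqrt (radialMass N))⁻¹),
    by positivity, ?_⟩
  intro Ω hΩ hne f hf hlap hint B hB x r hr hball v w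
  set E : ℝ := 2 ^ (((N : ℝ) + 1) / 2) * (Real.sqrt (radialMass N))⁻¹ * B *
    r ^ (-((N : ℝ) + 1) / 2) with hE
  have hB0 : 0 ≤ B := hB ▸ Real.sqrt_nonneg _
  have hE0 : 0 ≤ E := by positivity
  have hle : ∀ i j, |hessEntry f x i j| ≤ E := by
    intro i j
    have h1 := hessEntry_sq_mul_le hΩ hne hf hlap hint (half_pos hr)
      (by rwa [mul_div_cancel₀ r two_ne_zero]) i j
    have h2 : ∫ x in Ω, infDist x (frontier Ω) * hessNormSq f x = B ^ 2 := by
      rw [hB, Real.sq_sqrt]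
      exact integral_nonneg fun y => mul_nonneg infDist_nonneg (hessNormSq_nonneg f y)
    rw [h2] at h1
    refine abs_le_of_sq_le_sq ?_ hE0
    have h3 : E ^ 2 = B ^ 2 / (radialMass N * (r / 2) ^ (N + 1)) := by
      have e1 : ((2 : ℝ) ^ (((N : ℝ) + 1) / 2)) ^ 2 = 2 ^ (N + 1) := by
        rw [← Real.rpow_natCast, ← Real.rpow_mul (by norm_num), ← Real.rpow_natCast]
        congr 1; push_cast; ring
      have e2 : (r ^ (-((N : ℝ) + 1) / 2)) ^ 2 = (r ^ (N + 1))⁻¹ := by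
        rw [← Real.rpow_natCast, ← Real.rpow_mul hr.le, ← Real.rpow_natCast,
          ← Real.rpow_neg hr.le]
        congr 1; push_cast; ring
      rw [hE, mul_pow, mul_pow, mul_pow, e1, e2, inv_pow, Real.sq_sqrt hm.le, div_pow]
      field_simp
    rw [h3, le_div_iff₀ (by positivity)]
    linarith
  refine (abs_dirDeriv_dirDeriv_le hΩ hf (hball (mem_ball_self hr)) hle).trans ?_
  have : (N : ℝ) ^ 2 * E ≤ (N ^ 2 + 1) * E := by gcongr; linarith
  calc (N : ℝ) ^ 2 * E * ‖v‖ * ‖w‖ ≤ (N ^ 2 + 1) * E * ‖v‖ * ‖w‖ := by gcongr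
    _ = _ := by rw [hE]; ring

/-- `ω` is an interior cone direction for all points of `closure Ω` at distance less than `r`
from `w`. -/
def IsConeDir {N : ℕ} (θ r : ℝ) (Ω : Set (Euc N)) (w ω : Euc N) : Prop :=
  ‖ω‖ = 1 ∧ ∀ w' ∈ closure Ω, dist w' w < r → ∀ y : Euc N,
    ⟪y, ω⟫ > ‖y‖ * Real.cos θ → ‖y‖ < r → w' + y ∈ Ω

lemma ball_subset_of_disjoint_frontier {N : ℕ} {Ω : Set (Euc N)} {x w : Euc N} {r : ℝ}
    (hx : x ∈ Ω) (hxr : x ∈ ball w r) (h : ball w r ∩ frontier Ω = ∅) : ball w r ⊆ Ω := by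
  by_contra hn
  obtain ⟨y, hy, hyn⟩ := not_subset.1 hn
  have hpre : IsPreconnected (ball w r) := (convex_ball w r).isPreconnected
  have hcov : ∀ p ∈ ball w r, p ∈ interior Ω ∨ p ∉ closure Ω := fun p hp => by
    by_contra hcon
    push Not at hcon
    exact (h ▸ ⟨hp, hcon.2, hcon.1⟩ : p ∈ (∅ : Set (Euc N)))
  have hxi : x ∈ interior Ω := (hcov x hxr).resolve_right (not_not.2 (subset_closure hx))
  have hyc : y ∉ closure Ω := (hcov y hy).resolve_left fun hi => hyn (interior_subset hi)
  obtain ⟨p, -, hp1, hp2⟩ := hpre (interior Ω) (closure Ω)ᶜ isOpen_interior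
    isClosed_closure.isOpen_compl hcov ⟨x, hxr, hxi⟩ ⟨y, hy, hyc⟩
  exact hp2 (subset_closure (interior_subset hp1))

lemma exists_isConeDir {N : ℕ} (hN : 2 ≤ N) {θ a : ℝ} (ha : 0 < a) {Ω : Set (Euc N)}
    (hcone : UnifConeCond θ a Ω) {w : Euc N} (hw : w ∈ Ω) : ∃ ω, IsConeDir θ (a / 4) Ω w ω := by
  by_cases hx : ∃ x ∈ frontier Ω, dist x w < a / 2
  · obtain ⟨x, hxf, hxw⟩ := hx
    obtain ⟨ω, hω, h⟩ := hcone x hxf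
    refine ⟨ω, hω, fun w' hw' hd y hy hya => h w' ⟨?_, hw'⟩ y hy (by linarith)⟩
    have := dist_triangle w' w x
    rw [dist_comm w x] at this
    rw [mem_ball]; linarith
  · push Not at hx
    have hball : ball w (a / 2) ⊆ Ω := by
      refine ball_subset_of_disjoint_frontier hw (mem_ball_self (by positivity)) ?_
      ext y
      simp only [mem_inter_iff, mem_ball, mem_empty_iff_false, iff_false, not_and]
      intro hy hyf
      exact absurd hy (not_lt.2 (hx y hyf))
    refine ⟨EuclideanSpace.single ⟨0, by omega⟩ 1, by simp, fun w' _ hd y _ hya => hball ?_⟩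
    have : dist (w' + y) w ≤ dist (w' + y) w' + dist w' w := dist_triangle _ _ _
    rw [dist_self_add_left] at this
    rw [mem_ball]; linarith

lemma inner_gt_of_norm_lt {N : ℕ} {θ : ℝ} (hθ : θ ∈ Ioc (0 : ℝ) (π / 2)) {ω ζ : Euc N}
    (hω : ‖ω‖ = 1) {t : ℝ} (ht : 0 < t) (hζ : ‖ζ‖ < t * Real.sin θ) :
    ⟪t • ω + ζ, ω⟫ > ‖t • ω + ζ‖ * Real.cos θ := by
  have hc0 : 0 ≤ Real.cos θ := Real.cos_nonneg_of_mem_Icc ⟨by linarith [hθ.1, Real.pi_pos], hθ.2⟩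
  have hs0 : 0 < Real.sin θ := Real.sin_pos_of_pos_of_lt_pi hθ.1 (by linarith [hθ.2, Real.pi_pos])
  have hs1 := Real.sin_le_one θ
  have hsc := Real.sin_sq_add_cos_sq θ
  have hin : ⟪t • ω + ζ, ω⟫ = t + ⟪ζ, ω⟫ := by
    rw [inner_add_left, real_inner_smul_left, real_inner_self_eq_norm_sq, hω]; ring
  have hnorm : ‖t • ω + ζ‖ ^ 2 = t ^ 2 + 2 * t * ⟪ζ, ω⟫ + ‖ζ‖ ^ 2 := by
    rw [norm_add_sq_real, norm_smul, hω, real_inner_smul_left, real_inner_comm, mul_one,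
      Real.norm_eq_abs, sq_abs]
    ring
  have hp : |⟪ζ, ω⟫| ≤ ‖ζ‖ := by simpa [hω] using abs_real_inner_le_norm ζ ω
  rw [hin]
  set p : ℝ := ⟪ζ, ω⟫
  have hζt : ‖ζ‖ < t := hζ.trans_le (mul_le_of_le_one_right ht.le hs1)
  have hpos : 0 < t + p := by linarith [neg_abs_le p]
  rcases hc0.eq_or_lt with hc | hc
  · rw [← hc, mul_zero]; exact hpos
  · refine lt_of_pow_lt_pow_left₀ 2 hpos.le ?_
    rw [mul_pow, hnorm]
    have h1 : ‖ζ‖ ^ 2 < t ^ 2 * Real.sin θ ^ 2 := by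
      rw [← mul_pow]; exact pow_lt_pow_left₀ hζ (norm_nonneg _) two_ne_zero
    have h2 := mul_lt_mul_of_pos_right h1 (pow_pos hc 2)
    have hs2 : Real.cos θ ^ 2 = 1 - Real.sin θ ^ 2 := by linarith
    rw [hs2] at h2 ⊢
    nlinarith [sq_nonneg (t * Real.sin θ ^ 2 + p)]

lemma IsConeDir.ball_subset {N : ℕ} {θ r : ℝ} (hθ : θ ∈ Ioc (0 : ℝ) (π / 2)) {Ω : Set (Euc N)}
    {w ω : Euc N} (h : IsConeDir θ r Ω w ω) {w' : Euc N} (hw' : w' ∈ closure Ω)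
    (hd : dist w' w < r) {t : ℝ} (ht : 0 < t) (htr : 2 * t ≤ r) :
    ball (w' + t • ω) (t * Real.sin θ) ⊆ Ω := by
  intro y hy
  rw [mem_ball, dist_eq_norm] at hy
  have e : y = w' + (t • ω + (y - (w' + t • ω))) := by abel
  rw [e]
  refine h.2 w' hw' hd _ (inner_gt_of_norm_lt hθ h.1 ht hy) ?_
  have h1 := norm_add_le (t • ω) (y - (w' + t • ω))
  rw [norm_smul, h.1, mul_one, Real.norm_of_nonneg ht.le] at h1
  have : t * Real.sin θ ≤ t := mul_le_of_le_one_right ht.le (Real.sin_le_one θ)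
  linarith

lemma IsConeDir.add_smul_mem {N : ℕ} {θ r : ℝ} (hθ : θ ∈ Ioc (0 : ℝ) (π / 2)) {Ω : Set (Euc N)}
    {w ω : Euc N} (h : IsConeDir θ r Ω w ω) {w' : Euc N} (hw' : w' ∈ Ω)
    (hd : dist w' w < r) {t : ℝ} (ht : 0 ≤ t) (htr : 2 * t ≤ r) : w' + t • ω ∈ Ω := by
  rcases ht.eq_or_lt with rfl | ht
  · simpa using hw'
  · have hs0 : 0 < Real.sin θ :=
      Real.sin_pos_of_pos_of_lt_pi hθ.1 (by linarith [hθ.2, Real.pi_pos])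
    exact h.ball_subset hθ (subset_closure hw') hd ht htr (mem_ball_self (by positivity))

lemma mem_segment_add_smul {N : ℕ} {p ω y : Euc N} {s : ℝ} (hs : 0 ≤ s)
    (hy : y ∈ segment ℝ p (p + s • ω)) : ∃ τ, 0 ≤ τ ∧ τ ≤ s ∧ y = p + τ • ω := by
  rw [segment_eq_image'] at hy
  obtain ⟨c, hc, rfl⟩ := hy
  refine ⟨c * s, mul_nonneg hc.1 hs, mul_le_of_le_one_left hs hc.2, ?_⟩
  simp [mul_smul]

lemma dist_add_smul_self {N : ℕ} {p ω : Euc N} (hω : ‖ω‖ = 1) {s : ℝ} (hs : 0 ≤ s) :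
    dist p (p + s • ω) = s := by
  rw [dist_self_add_right, norm_smul, hω, mul_one, Real.norm_of_nonneg hs]

/-- `f` is `L`-Lipschitz along segments all of whose points have distance at least `ρ` from the
complement of `Ω`. -/
def LipAtDepth {N : ℕ} (Ω : Set (Euc N)) (ρ L : ℝ) (f : Euc N → ℝ) : Prop :=
  ∀ p q, (∀ y ∈ segment ℝ p q, ball y ρ ⊆ Ω) → |f p - f q| ≤ L * dist p q

section Pushing

variable {N : ℕ} {θ r s L : ℝ} {Ω : Set (Euc N)} {f : Euc N → ℝ}

lemma LipAtDepth.abs_sub_push_push_le (hθ : θ ∈ Ioc (0 : ℝ) (π / 2)) (hs : 0 < s)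
    (hsr : 4 * s ≤ r) (hf : LipAtDepth Ω (s * Real.sin θ / 2) L f) {w w' w₀ ω ω' : Euc N}
    (h : IsConeDir θ r Ω w ω) (h' : IsConeDir θ r Ω w' ω') (hw₀ : w₀ ∈ Ω)
    (hd : dist w₀ w < r / 2) (hd' : dist w₀ w' < r / 2) :
    |f (w₀ + s • ω) - f (w₀ + s • ω + s • ω')| ≤ L * s := by
  have := hf (w₀ + s • ω) (w₀ + s • ω + s • ω') ?_
  · rwa [dist_add_smul_self h'.1 hs.le] at this
  intro y hy
  obtain ⟨τ, hτ0, hτs, rfl⟩ := mem_segment_add_smul hs.le hy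
  have hmem : w₀ + τ • ω' ∈ Ω :=
    h'.add_smul_mem hθ hw₀ (by linarith) hτ0 (by linarith)
  have hdist : dist (w₀ + τ • ω') w < r := by
    have h1 := dist_triangle (w₀ + τ • ω') w₀ w
    rw [dist_comm _ w₀, dist_add_smul_self h'.1 hτ0] at h1
    linarith
  have h2 := h.ball_subset hθ (subset_closure hmem) hdist hs (by linarith)
  have hs0 : 0 < Real.sin θ :=
    Real.sin_pos_of_pos_of_lt_pi hθ.1 (by linarith [hθ.2, Real.pi_pos])
  have e : w₀ + s • ω + τ • ω' = w₀ + τ • ω' + s • ω := by abel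
  rw [e]
  exact (ball_subset_ball (by nlinarith)).trans h2

lemma LipAtDepth.abs_sub_le_of_dist_le {ρ : ℝ} (hf : LipAtDepth Ω (ρ / 2) L f)
    {p q : Euc N} (hp : ball p ρ ⊆ Ω) (hpq : dist p q ≤ ρ / 2) : |f p - f q| ≤ L * dist p q := by
  refine hf p q fun y hy => (ball_subset_ball' ?_).trans hp
  have hy' : y ∈ closedBall p (ρ / 2) :=
    (convex_closedBall p (ρ / 2)).segment_subset
      (mem_closedBall_self (dist_nonneg.trans hpq)) (by rwa [mem_closedBall, dist_comm]) hy
  rw [mem_closedBall] at hy'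
  linarith

lemma LipAtDepth.abs_sub_push_le (hL : 0 ≤ L) (hθ : θ ∈ Ioc (0 : ℝ) (π / 2)) (hs : 0 < s)
    (hsr : 4 * s ≤ r) (hf : LipAtDepth Ω (s * Real.sin θ / 2) L f) {w w' ω ω' : Euc N}
    (h : IsConeDir θ r Ω w ω) (h' : IsConeDir θ r Ω w' ω') (hw : w ∈ Ω) (hw' : w' ∈ Ω)
    (hd : dist w w' < s * Real.sin θ / 2) :
    |f (w + s • ω) - f (w' + s • ω')| ≤ 3 * L * s := by
  have hs0 : 0 < Real.sin θ :=
    Real.sin_pos_of_pos_of_lt_pi hθ.1 (by linarith [hθ.2, Real.pi_pos])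
  have hσ : s * Real.sin θ ≤ s := mul_le_of_le_one_right hs.le (Real.sin_le_one θ)
  have hr : 0 < r := by linarith
  have h1 := hf.abs_sub_push_push_le hθ hs hsr h h' hw (by simpa using hr) (by linarith)
  have h2 := hf.abs_sub_push_push_le hθ hs hsr h' h hw' (by simpa using hr)
    (by rw [dist_comm]; linarith)
  have hmem : w + s • ω' ∈ Ω := h'.add_smul_mem hθ hw (by linarith) hs.le (by linarith)
  have hdist : dist (w + s • ω') w < r := by
    rw [dist_comm, dist_add_smul_self h'.1 hs.le]; linarith
  have h3 := h.ball_subset hθ (subset_closure hmem) hdist hs (by linarith)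
  have h4 : dist (w + s • ω' + s • ω) (w' + s • ω' + s • ω) = dist w w' := by
    rw [dist_add_right, dist_add_right]
  have h5 := hf.abs_sub_le_of_dist_le h3 (h4.le.trans hd.le)
  rw [h4] at h5
  have e : w + s • ω + s • ω' = w + s • ω' + s • ω := by abel
  rw [e] at h1
  have h6 : L * dist w w' ≤ L * s := mul_le_mul_of_nonneg_left (by linarith) hL
  rw [abs_le] at *
  constructor <;> linarith [h1.1, h1.2, h2.1, h2.2, h5.1, h5.2]

lemma LipAtDepth.abs_sub_self_push_le (hθ : θ ∈ Ioc (0 : ℝ) (π / 2)) (hs : 0 < s)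
    (hsr : 4 * s ≤ r) (hf : LipAtDepth Ω (s * Real.sin θ / 2) L f) {p ω : Euc N}
    (h : IsConeDir θ r Ω p ω) (hp : ball p (s * Real.sin θ) ⊆ Ω) :
    |f p - f (p + s • ω)| ≤ L * s := by
  have := hf p (p + s • ω) ?_
  · rwa [dist_add_smul_self h.1 hs.le] at this
  intro y hy
  have hs0 : 0 < Real.sin θ :=
    Real.sin_pos_of_pos_of_lt_pi hθ.1 (by linarith [hθ.2, Real.pi_pos])
  have hσ : s * Real.sin θ ≤ s := mul_le_of_le_one_right hs.le (Real.sin_le_one θ)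
  obtain ⟨τ, hτ0, hτs, rfl⟩ := mem_segment_add_smul hs.le hy
  intro z hz
  have e : z = z - τ • ω + τ • ω := by abel
  have hz' : dist (z - τ • ω) p < s * Real.sin θ / 2 := by
    rw [mem_ball, dist_eq_norm] at hz
    rw [dist_eq_norm]
    convert hz using 2
    abel
  rw [e]
  refine h.add_smul_mem hθ (hp ?_) (by linarith) hτ0 (by linarith)
  rw [mem_ball]
  have : 0 < s * Real.sin θ := by positivity
  linarith

/-- Every value between two pushed values is nearly attained at depth. -/
lemma LipAtDepth.exists_near_value (hL : 0 ≤ L) (hθ : θ ∈ Ioc (0 : ℝ) (π / 2)) (hs : 0 < s)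
    (hsr : 4 * s ≤ r) (hf : LipAtDepth Ω (s * Real.sin θ / 2) L f) (hΩc : IsPreconnected Ω)
    (hdir : ∀ w ∈ Ω, ∃ ω, IsConeDir θ r Ω w ω) {p q ω ω' : Euc N} (hp : p ∈ Ω) (hq : q ∈ Ω)
    (h : IsConeDir θ r Ω p ω) (h' : IsConeDir θ r Ω q ω') {c : ℝ} (hc1 : f (p + s • ω) ≤ c)
    (hc2 : c ≤ f (q + s • ω')) :
    ∃ y, ball y (s * Real.sin θ) ⊆ Ω ∧ |f y - c| ≤ 3 * L * s := by
  have hs0 : 0 < Real.sin θ :=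
    Real.sin_pos_of_pos_of_lt_pi hθ.1 (by linarith [hθ.2, Real.pi_pos])
  have hσ : 0 < s * Real.sin θ := by positivity
  set A : Set (Euc N) := {w | w ∈ Ω ∧ ∃ ω, IsConeDir θ r Ω w ω ∧ f (w + s • ω) ≤ c}
  set A' : Set (Euc N) := {w | w ∈ Ω ∧ ∃ ω, IsConeDir θ r Ω w ω ∧ c ≤ f (w + s • ω)}
  have hsub : ∀ S : Set (Euc N), S ⊆ thickening (s * Real.sin θ / 4) S :=
    fun S => self_subset_thickening (by positivity) S
  obtain ⟨x, -, hxA, hxA'⟩ := hΩc (thickening (s * Real.sin θ / 4) A)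
    (thickening (s * Real.sin θ / 4) A') isOpen_thickening isOpen_thickening
    (fun w hw => by
      obtain ⟨η, hη⟩ := hdir w hw
      rcases le_total (f (w + s • η)) c with hle | hle
      · exact Or.inl (hsub _ ⟨hw, η, hη, hle⟩)
      · exact Or.inr (hsub _ ⟨hw, η, hη, hle⟩))
    ⟨p, hp, hsub _ ⟨hp, ω, h, hc1⟩⟩ ⟨q, hq, hsub _ ⟨hq, ω', h', hc2⟩⟩
  obtain ⟨w, ⟨hw, η, hη, hwc⟩, hxw⟩ := mem_thickening_iff.1 hxA
  obtain ⟨w', ⟨hw', η', hη', hwc'⟩, hxw'⟩ := mem_thickening_iff.1 hxA'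
  have hd : dist w w' < s * Real.sin θ / 2 := by
    have := dist_triangle_left w w' x
    linarith
  have key := hf.abs_sub_push_le hL hθ hs hsr hη hη' hw hw' hd
  refine ⟨w + s • η, hη.ball_subset hθ (subset_closure hw) (by simp; linarith) hs (by linarith), ?_⟩
  rw [abs_le] at key ⊢
  constructor <;> nlinarith [key.1, key.2]

end Pushing

/-- Uniform control of the oscillation at a given depth, by a pigeonhole argument. -/
lemma exists_osc_bound (N : ℕ) (hN : 2 ≤ N) {θ a d s : ℝ} (hθ : θ ∈ Ioc (0 : ℝ) (π / 2))
    (ha : 0 < a) (hd : 0 < d) (hs : 0 < s) (hsa : 16 * s ≤ a) :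
    ∃ K > (0 : ℝ), ∀ Ω : Set (Euc N), IsConnected Ω → Bornology.IsBounded Ω →
      Metric.diam Ω ≤ d → UnifConeCond θ a Ω → ∀ (f : Euc N → ℝ) (L : ℝ), 0 ≤ L →
      LipAtDepth Ω (s * Real.sin θ / 2) L f →
      ∀ p q, ball p (s * Real.sin θ) ⊆ Ω → ball q (s * Real.sin θ) ⊆ Ω →
        |f p - f q| ≤ K * L := by
  have hs0 : 0 < Real.sin θ :=
    Real.sin_pos_of_pos_of_lt_pi hθ.1 (by linarith [hθ.2, Real.pi_pos])
  have hσ : 0 < s * Real.sin θ := by positivity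
  have hσs : s * Real.sin θ ≤ s := mul_le_of_le_one_right hs.le (Real.sin_le_one θ)
  obtain ⟨t, -, htfin, hcover⟩ := (isCompact_closedBall (0 : Euc N) d).finite_cover_balls
    (show 0 < s * Real.sin θ / 4 by positivity)
  lift t to Finset (Euc N) using htfin
  have htne : 0 < t.card := by
    rw [Finset.card_pos]
    obtain ⟨c, hc, -⟩ := mem_iUnion₂.1 (hcover (mem_closedBall_self hd.le))
    exact ⟨c, hc⟩
  have htne' : (0 : ℝ) < t.card := by exact_mod_cast htne
  refine ⟨2 * s + 7 * s * t.card, by positivity, ?_⟩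
  intro Ω hΩc hΩb hdiam hcone f L hL hf
  have hdir : ∀ w ∈ Ω, ∃ ω, IsConeDir θ (a / 4) Ω w ω :=
    fun w hw => exists_isConeDir hN ha hcone hw
  have hsr : 4 * s ≤ a / 4 := by linarith
  have main : ∀ p q, ball p (s * Real.sin θ) ⊆ Ω → ball q (s * Real.sin θ) ⊆ Ω →
      f q - f p ≤ (2 * s + 7 * s * t.card) * L := by
    intro p q hp hq
    have hpΩ := hp (mem_ball_self hσ)
    have hqΩ := hq (mem_ball_self hσ)
    obtain ⟨ω, hω⟩ := hdir p hpΩ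
    obtain ⟨ω', hω'⟩ := hdir q hqΩ
    have h1 := abs_le.1 (hf.abs_sub_self_push_le hθ hs hsr hω hp)
    have h2 := abs_le.1 (hf.abs_sub_self_push_le hθ hs hsr hω' hq)
    suffices h3 : f (q + s • ω') - f (p + s • ω) ≤ 7 * s * t.card * L by
      linarith [h1.1, h1.2, h2.1, h2.2]
    set α := f (p + s • ω)
    set β := f (q + s • ω')
    rcases le_total β α with hle | hle
    · exact (sub_nonpos.2 hle).trans (by positivity)
    set γ := (β - α) / t.card with hγ
    have hγ0 : 0 ≤ γ := div_nonneg (sub_nonneg.2 hle) htne'.le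
    have hval : ∀ j : Fin (t.card + 1), ∃ y, ball y (s * Real.sin θ) ⊆ Ω ∧
        |f y - (α + j * γ)| ≤ 3 * L * s := by
      intro j
      refine hf.exists_near_value hL hθ hs hsr hΩc.isPreconnected hdir hpΩ hqΩ hω hω' ?_ ?_
      · have : 0 ≤ (j : ℝ) * γ := by positivity
        linarith
      · have hj : (j : ℝ) ≤ t.card := by exact_mod_cast Nat.lt_succ_iff.1 j.2
        have : (j : ℝ) * γ ≤ t.card * γ := by gcongr
        have e : t.card * γ = β - α := by rw [hγ]; field_simp
        change α + j * γ ≤ β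
        linarith
    choose y hyb hyv using hval
    have hcenter : ∀ j, ∃ c : t, dist (y j - p) c < s * Real.sin θ / 4 := by
      intro j
      have hyj : y j - p ∈ closedBall (0 : Euc N) d := by
        rw [mem_closedBall_zero_iff, ← dist_eq_norm]
        exact (dist_le_diam_of_mem hΩb (hyb j (mem_ball_self hσ)) hpΩ).trans hdiam
      obtain ⟨c, hc, hcj⟩ := mem_iUnion₂.1 (hcover hyj)
      exact ⟨⟨c, hc⟩, hcj⟩
    choose c hc using hcenter
    obtain ⟨i, j, hij, hcij⟩ := Fintype.exists_ne_map_eq_of_card_lt c (by simp)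
    have hdist : dist (y i) (y j) ≤ s * Real.sin θ / 2 := by
      have h4 := dist_triangle_right (y i - p) (y j - p) (c i : Euc N)
      have h5 := hc i
      have h6 := hc j
      rw [← hcij] at h6
      rw [dist_sub_right] at h4
      linarith
    have h7 := hf.abs_sub_le_of_dist_le (hyb i) hdist
    have h8 : L * dist (y i) (y j) ≤ L * s := mul_le_mul_of_nonneg_left (by linarith) hL
    have h9 : γ ≤ |(i : ℝ) * γ - j * γ| := by
      rw [← sub_mul, abs_mul, abs_of_nonneg hγ0]
      refine le_mul_of_one_le_left hγ0 ?_
      have hne : ((i : ℕ) : ℤ) - ((j : ℕ) : ℤ) ≠ 0 := by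
        intro h0
        exact hij (Fin.ext (by omega))
      have := Int.one_le_abs hne
      exact_mod_cast this
    have h10 : |(i : ℝ) * γ - j * γ| ≤ 7 * s * L := by
      have hi := abs_le.1 (hyv i)
      have hj := abs_le.1 (hyv j)
      rw [abs_le] at h7 ⊢
      constructor <;> nlinarith [hi.1, hi.2, hj.1, hj.2, h7.1, h7.2]
    calc β - α = t.card * γ := by rw [hγ]; field_simp
      _ ≤ t.card * (7 * s * L) := by gcongr; exact h9.trans h10
      _ = _ := by ring
  intro p q hp hq
  rw [abs_le]
  constructor <;> linarith [main p q hp hq, main q p hq hp]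

/-- The rate of the stability estimate, as a function of the dimension, of the bound `M` for the
gradient and of the weighted `L²` norm `B` of the Hessian. -/
def stabRate (N : ℕ) (M B : ℝ) : ℝ :=
  if N = 2 then B else if N = 3 then B * max (Real.log (Real.exp 1 * M / B)) 1
  else M ^ (((N : ℝ) - 3) / ((N : ℝ) - 1)) * B ^ ((2 : ℝ) / ((N : ℝ) - 1))

lemma stabRate_nonneg {N : ℕ} {M B : ℝ} (hM : 0 ≤ M) (hB : 0 ≤ B) : 0 ≤ stabRate N M B := by
  unfold stabRate
  split_ifs <;> positivity

lemma rpow_mul_rpow_stabRate {N : ℕ} (hN : 4 ≤ N) {M : ℝ} (hM : 0 ≤ M) :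
    M ^ (((N : ℝ) - 3) / ((N : ℝ) - 1)) * M ^ ((2 : ℝ) / ((N : ℝ) - 1)) = M := by
  have h4 : (4 : ℝ) ≤ N := by exact_mod_cast hN
  have hne : (N : ℝ) - 1 ≠ 0 := by linarith
  rw [← Real.rpow_add_of_nonneg hM (div_nonneg (by linarith) (by linarith))
    (div_nonneg (by linarith) (by linarith)), ← add_div,
    show (N : ℝ) - 3 + 2 = N - 1 by ring, div_self hne, Real.rpow_one]

lemma min_le_stabRate {N : ℕ} (hN : 2 ≤ N) {M B : ℝ} (hM : 0 ≤ M) (hB : 0 ≤ B) :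
    min M B ≤ stabRate N M B := by
  unfold stabRate
  split_ifs with h2 h3
  · exact min_le_right _ _
  · exact (min_le_right _ _).trans (le_mul_of_one_le_right hB (le_max_right _ _))
  · have h4 : 4 ≤ N := by omega
    have h4' : (4 : ℝ) ≤ N := by exact_mod_cast h4
    have hm : 0 ≤ min M B := le_min hM hB
    have hα : 0 ≤ ((N : ℝ) - 3) / ((N : ℝ) - 1) := div_nonneg (by linarith) (by linarith)
    have hβ : 0 ≤ (2 : ℝ) / ((N : ℝ) - 1) := div_nonneg (by linarith) (by linarith)
    calc min M B = min M B ^ (((N : ℝ) - 3) / ((N : ℝ) - 1)) *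
          min M B ^ ((2 : ℝ) / ((N : ℝ) - 1)) := (rpow_mul_rpow_stabRate h4 hm).symm
      _ ≤ _ := mul_le_mul (Real.rpow_le_rpow hm (min_le_left _ _) hα)
          (Real.rpow_le_rpow hm (min_le_right _ _) hβ) (by positivity) (by positivity)

lemma abs_sub_le_of_abs_deriv_le {φ φ' ψ ψ' : ℝ → ℝ} {a b : ℝ} (hab : a ≤ b)
    (hφ : ContinuousOn φ (Icc a b)) (hψ : ContinuousOn ψ (Icc a b))
    (hφ' : ∀ t ∈ Ioo a b, HasDerivAt φ (φ' t) t) (hψ' : ∀ t ∈ Ioo a b, HasDerivAt ψ (ψ' t) t)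
    (h : ∀ t ∈ Ioo a b, |φ' t| ≤ ψ' t) : |φ b - φ a| ≤ ψ b - ψ a := by
  have hm : MonotoneOn (fun t => ψ t - φ t) (Icc a b) := by
    refine monotoneOn_of_hasDerivWithinAt_nonneg (f' := fun t => ψ' t - φ' t) (convex_Icc a b)
      (hψ.sub hφ) (fun t ht => ?_) fun t ht => ?_ <;> rw [interior_Icc] at ht
    · exact ((hψ' t ht).sub (hφ' t ht)).hasDerivWithinAt
    · linarith [(abs_le.1 (h t ht)).2]
  have hp : MonotoneOn (fun t => ψ t + φ t) (Icc a b) := by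
    refine monotoneOn_of_hasDerivWithinAt_nonneg (f' := fun t => ψ' t + φ' t) (convex_Icc a b)
      (hψ.add hφ) (fun t ht => ?_) fun t ht => ?_ <;> rw [interior_Icc] at ht
    · exact ((hψ' t ht).add (hφ' t ht)).hasDerivWithinAt
    · linarith [(abs_le.1 (h t ht)).1]
  have h1 := hm (left_mem_Icc.2 hab) (right_mem_Icc.2 hab) hab
  have h2 := hp (left_mem_Icc.2 hab) (right_mem_Icc.2 hab) hab
  simp only at h1 h2
  rw [abs_le]
  constructor <;> linarith

lemma abs_sub_le_of_abs_deriv_le_const {φ φ' : ℝ → ℝ} {a b K : ℝ} (hab : a ≤ b)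
    (hφ : ContinuousOn φ (Icc a b)) (hφ' : ∀ t ∈ Ioo a b, HasDerivAt φ (φ' t) t)
    (h : ∀ t ∈ Ioo a b, |φ' t| ≤ K) : |φ b - φ a| ≤ K * (b - a) := by
  have := abs_sub_le_of_abs_deriv_le (ψ := fun t => K * t) (ψ' := fun _ => K) hab hφ
    (by fun_prop) hφ' (fun t _ => by simpa using (hasDerivAt_id t).const_mul K) h
  linarith

/-- The singular bound `t ^ (-(N - 1) / 2)` for the derivative, combined with a uniform bound,
controls the variation of `φ` up to the singularity. -/
lemma abs_sub_le_stabRate {N : ℕ} (hN : 2 ≤ N) {s C : ℝ} (hs : 0 < s) (hC : 0 ≤ C) :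
    ∃ K > (0 : ℝ), ∀ {M B : ℝ}, 0 ≤ M → 0 ≤ B → ∀ {φ φ' : ℝ → ℝ}, ContinuousOn φ (Icc 0 s) →
      (∀ t ∈ Ioo 0 s, HasDerivAt φ (φ' t) t) → (∀ t ∈ Ioo 0 s, |φ' t| ≤ 2 * M) →
      (∀ t ∈ Ioo 0 s, |φ' t| ≤ C * B * t ^ (-((N : ℝ) - 1) / 2)) →
      |φ s - φ 0| ≤ K * stabRate N M B := by
  obtain rfl | hN3 : N = 2 ∨ 3 ≤ N := by omega
  · refine ⟨2 * C * √s + 1, by positivity, fun {M B} hM hB φ φ' hφ hφ' _ hB' => ?_⟩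
    have := abs_sub_le_of_abs_deriv_le (ψ := fun t => 2 * C * B * √t)
      (ψ' := fun t => 2 * C * B * (1 / (2 * √t))) hs.le hφ (by fun_prop) hφ'
      (fun t ht => (Real.hasDerivAt_sqrt ht.1.ne').const_mul _) fun t ht => by
        refine (hB' t ht).trans_eq ?_
        rw [show -(((2 : ℕ) : ℝ) - 1) / 2 = -(1 / 2) by norm_num, Real.rpow_neg ht.1.le,
          ← Real.sqrt_eq_rpow]
        ring
    simp only [Real.sqrt_zero, mul_zero, sub_zero] at this
    simp only [stabRate, if_true]
    nlinarith
  obtain ⟨K, hK, hK'⟩ : ∃ K > (0 : ℝ), ∀ {M B ε : ℝ}, 0 < B → B < M →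
      ε = s * (B / M) ^ ((2 : ℝ) / ((N : ℝ) - 1)) → ∀ {φ φ' : ℝ → ℝ}, ContinuousOn φ (Icc ε s) →
      (∀ t ∈ Ioo ε s, HasDerivAt φ (φ' t) t) →
      (∀ t ∈ Ioo ε s, |φ' t| ≤ C * B * t ^ (-((N : ℝ) - 1) / 2)) →
      2 * M * ε + |φ s - φ ε| ≤ K * stabRate N M B := by
    obtain rfl | hN4 : N = 3 ∨ 4 ≤ N := by omega
    · refine ⟨2 * s + C, by positivity, fun {M B ε} hB hBM hε φ φ' hφ hφ' hB' => ?_⟩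
      have hM : 0 < M := hB.trans hBM
      have hε' : ε = s * (B / M) := by
        rw [hε, show (2 : ℝ) / (((3 : ℕ) : ℝ) - 1) = 1 by norm_num, Real.rpow_one]
      have hε0 : 0 < ε := by rw [hε']; positivity
      have hεs : ε ≤ s := by
        rw [hε']; exact mul_le_of_le_one_right hs.le ((div_le_one hM).2 hBM.le)
      have := abs_sub_le_of_abs_deriv_le (ψ := fun t => C * B * Real.log t)
        (ψ' := fun t => C * B * t⁻¹) hεs hφ
        (continuousOn_const.mul (Real.continuousOn_log.mono fun t ht =>
          (hε0.trans_le ht.1).ne')) hφ'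
        (fun t ht => (Real.hasDerivAt_log (hε0.trans ht.1).ne').const_mul _) fun t ht => by
          refine (hB' t ht).trans_eq ?_
          rw [show -(((3 : ℕ) : ℝ) - 1) / 2 = -1 by norm_num, Real.rpow_neg_one]
      have e1 : Real.log s - Real.log ε ≤ max (Real.log (Real.exp 1 * M / B)) 1 := by
        refine le_max_of_le_left ?_
        rw [← Real.log_div hs.ne' hε0.ne', hε']
        refine Real.log_le_log (by positivity) ?_
        rw [show s / (s * (B / M)) = M / B by field_simp, mul_div_assoc]
        refine le_mul_of_one_le_left (by positivity) ?_
        exact Real.one_le_exp zero_le_one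
      have e2 : 2 * M * ε = 2 * s * B := by rw [hε']; field_simp
      have e3 : C * B * (Real.log s - Real.log ε) ≤
          C * B * max (Real.log (Real.exp 1 * M / B)) 1 := by gcongr
      have e4 : 2 * s * B ≤ 2 * s * (B * max (Real.log (Real.exp 1 * M / B)) 1) := by
        gcongr
        exact le_mul_of_one_le_right hB.le (le_max_right _ _)
      simp only [stabRate, if_true, if_neg (show (3 : ℕ) ≠ 2 by decide)]
      linarith
    · have h4 : (4 : ℝ) ≤ N := by exact_mod_cast hN4
      have h1 : (0 : ℝ) < (N : ℝ) - 1 := by linarith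
      have h3 : (0 : ℝ) < (N : ℝ) - 3 := by linarith
      refine ⟨2 * s + C * (2 / ((N : ℝ) - 3)) * s ^ (-((N : ℝ) - 3) / 2), by positivity,
        fun {M B ε} hB hBM hε φ φ' hφ hφ' hB' => ?_⟩
      have hM : 0 < M := hB.trans hBM
      have hε0 : 0 < ε := by rw [hε]; positivity
      have hεs : ε ≤ s := by
        rw [hε]
        refine mul_le_of_le_one_right hs.le (Real.rpow_le_one (by positivity)
          ((div_le_one hM).2 hBM.le) (by positivity))
      have := abs_sub_le_of_abs_deriv_le
        (ψ := fun t => -(C * B * (2 / ((N : ℝ) - 3))) * t ^ (-((N : ℝ) - 3) / 2))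
        (ψ' := fun t => -(C * B * (2 / ((N : ℝ) - 3))) *
          ((-((N : ℝ) - 3) / 2) * t ^ (-((N : ℝ) - 3) / 2 - 1))) hεs hφ
        (continuousOn_const.mul (continuousOn_id.rpow_const fun t ht =>
          Or.inl (hε0.trans_le ht.1).ne')) hφ'
        (fun t ht => (Real.hasDerivAt_rpow_const (Or.inl (hε0.trans ht.1).ne')).const_mul _)
        fun t ht => by
          refine (hB' t ht).trans_eq ?_
          rw [show -((N : ℝ) - 3) / 2 - 1 = -((N : ℝ) - 1) / 2 by ring]
          field_simp
      have hrate : stabRate N M B =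
          M ^ (((N : ℝ) - 3) / ((N : ℝ) - 1)) * B ^ ((2 : ℝ) / ((N : ℝ) - 1)) := by
        simp only [stabRate, if_neg (show N ≠ 2 by omega), if_neg (show N ≠ 3 by omega)]
      have e1 : M * ε = s * stabRate N M B := by
        have hMp : M ^ ((2 : ℝ) / ((N : ℝ) - 1)) ≠ 0 := by positivity
        rw [hrate, hε, Real.div_rpow hB.le hM.le]
        nth_rewrite 1 [← rpow_mul_rpow_stabRate hN4 hM.le]
        field_simp
      have e2 : B * ε ^ (-((N : ℝ) - 3) / 2) = s ^ (-((N : ℝ) - 3) / 2) * stabRate N M B := by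
        have hBp : B ^ (((N : ℝ) - 3) / ((N : ℝ) - 1)) ≠ 0 := by positivity
        have hMp : M ^ (((N : ℝ) - 3) / ((N : ℝ) - 1)) ≠ 0 := by positivity
        rw [hrate, hε, Real.mul_rpow hs.le (by positivity), ← Real.rpow_mul (by positivity),
          show (2 : ℝ) / ((N : ℝ) - 1) * (-((N : ℝ) - 3) / 2) =
            -(((N : ℝ) - 3) / ((N : ℝ) - 1)) by field_simp,
          Real.rpow_neg (by positivity), Real.div_rpow hB.le hM.le]
        nth_rewrite 1 [← rpow_mul_rpow_stabRate hN4 hB.le]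
        field_simp
      have e3 : 0 ≤ C * B * (2 / ((N : ℝ) - 3)) * s ^ (-((N : ℝ) - 3) / 2) := by positivity
      have e4 : C * B * (2 / ((N : ℝ) - 3)) * ε ^ (-((N : ℝ) - 3) / 2) =
          C * (2 / ((N : ℝ) - 3)) * s ^ (-((N : ℝ) - 3) / 2) * stabRate N M B := by
        linear_combination C * (2 / ((N : ℝ) - 3)) * e2
      linarith
  refine ⟨K + 2 * s, by positivity, fun {M B} hM hB φ φ' hφ hφ' hM' hB' => ?_⟩
  have hR := stabRate_nonneg (N := N) hM hB
  rcases le_or_gt M B with hMB | hMB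
  · have h1 := abs_sub_le_of_abs_deriv_le_const hs.le hφ hφ' hM'
    have h2 := min_le_stabRate hN hM hB
    rw [min_eq_left hMB] at h2
    nlinarith
  rcases hB.eq_or_lt with rfl | hB0
  · have h1 := abs_sub_le_of_abs_deriv_le_const (K := 0) hs.le hφ hφ' fun t ht => by
      simpa using hB' t ht
    rw [zero_mul] at h1
    exact h1.trans (by positivity)
  set ε := s * (B / M) ^ ((2 : ℝ) / ((N : ℝ) - 1)) with hε
  have hM0 : 0 < M := hB0.trans hMB
  have hN1 : (0 : ℝ) < (N : ℝ) - 1 := by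
    have : (3 : ℝ) ≤ N := by exact_mod_cast hN3
    linarith
  have hε0 : 0 < ε := by positivity
  have hεs : ε ≤ s := mul_le_of_le_one_right hs.le (Real.rpow_le_one (by positivity)
    ((div_le_one hM0).2 hMB.le) (by positivity))
  have h1 := abs_sub_le_of_abs_deriv_le_const hε0.le (hφ.mono (Icc_subset_Icc_right hεs))
    (fun t ht => hφ' t ⟨ht.1, ht.2.trans_le hεs⟩) (fun t ht => hM' t ⟨ht.1, ht.2.trans_le hεs⟩)
  have h2 := hK' hB0 hMB hε (hφ.mono (Icc_subset_Icc_left hε0.le))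
    (fun t ht => hφ' t ⟨hε0.trans ht.1, ht.2⟩) (fun t ht => hB' t ⟨hε0.trans ht.1, ht.2⟩)
  have h3 := abs_sub_le (φ s) (φ ε) (φ 0)
  have h4 : 0 ≤ 2 * s * stabRate N M B := by positivity
  linarith

section BoundaryEstimate

variable {N : ℕ} {θ r s L : ℝ} {Ω : Set (Euc N)} {f : Euc N → ℝ}

lemma differentiableAt_of_contDiffOn {n : WithTop ℕ∞} (hn : n ≠ 0) (hΩ : IsOpen Ω)
    (hf : ContDiffOn ℝ n f Ω) {x : Euc N} (hx : x ∈ Ω) : DifferentiableAt ℝ f x :=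
  (hf.contDiffAt (hΩ.mem_nhds hx)).differentiableAt hn

lemma lipAtDepth_of_norm_fderiv_le {ρ : ℝ}
    (hf : ∀ x, ball x ρ ⊆ Ω → DifferentiableAt ℝ f x)
    (hL : ∀ x, ball x ρ ⊆ Ω → ‖fderiv ℝ f x‖ ≤ L) : LipAtDepth Ω ρ L f := by
  intro p q hpq
  rw [dist_comm, dist_eq_norm, abs_sub_comm, ← Real.norm_eq_abs]
  exact Convex.norm_image_sub_le_of_norm_fderiv_le (fun x hx => hf x (hpq x hx))
    (fun x hx => hL x (hpq x hx)) (convex_segment p q) (left_mem_segment ℝ p q)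
    (right_mem_segment ℝ p q)

lemma differentiableAt_dirDeriv (hΩ : IsOpen Ω) (hf : ContDiffOn ℝ 2 f Ω) (v : Euc N) {x : Euc N}
    (hx : x ∈ Ω) : DifferentiableAt ℝ (dirDeriv v f) x :=
  differentiableAt_of_contDiffOn one_ne_zero hΩ
    (contDiffOn_dirDeriv (n := 1) hΩ (by norm_num; exact hf) v) hx

lemma lipAtDepth_dirDeriv (hΩ : IsOpen Ω) (hf : ContDiffOn ℝ 2 f Ω) {D : ℝ} (hD : 0 ≤ D)
    (hH : ∀ {x : Euc N} {r : ℝ}, 0 < r → ball x r ⊆ Ω → ∀ v w : Euc N,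
      |dirDeriv w (dirDeriv v f) x| ≤ D * r ^ (-((N : ℝ) + 1) / 2) * ‖v‖ * ‖w‖)
    {ρ : ℝ} (hρ : 0 < ρ) (v : Euc N) :
    LipAtDepth Ω ρ (D * ρ ^ (-((N : ℝ) + 1) / 2) * ‖v‖) (dirDeriv v f) := by
  refine lipAtDepth_of_norm_fderiv_le
    (fun x hx => differentiableAt_dirDeriv hΩ hf v (hx (mem_ball_self hρ))) fun x hx => ?_
  refine ContinuousLinearMap.opNorm_le_bound _ (by positivity) fun w => ?_
  exact hH hρ hx v w

lemma hasDerivAt_comp_add_smul {x ω : Euc N} {t : ℝ} (hf : DifferentiableAt ℝ f (x + t • ω)) :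
    HasDerivAt (fun t : ℝ => f (x + t • ω)) (dirDeriv ω f (x + t • ω)) t := by
  have h1 : HasDerivAt (fun t : ℝ => x + t • ω) ω t := by
    refine HasDerivAt.congr_deriv (((hasDerivAt_id t).smul_const ω).const_add x) ?_
    simp
  exact hf.hasFDerivAt.comp_hasDerivAt t h1

/-- Integrating the interior estimate for the Hessian along the axis of an interior cone. -/
lemma IsConeDir.abs_dirDeriv_sub_le (hN : 2 ≤ N) (hθ : θ ∈ Ioc (0 : ℝ) (π / 2)) (hΩ : IsOpen Ω)
    (hf : ContDiffOn ℝ 2 f Ω) {D : ℝ} (hD : 0 ≤ D)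
    (hH : ∀ {x : Euc N} {r : ℝ}, 0 < r → ball x r ⊆ Ω → ∀ v w : Euc N,
      |dirDeriv w (dirDeriv v f) x| ≤ D * r ^ (-((N : ℝ) + 1) / 2) * ‖v‖ * ‖w‖)
    {x ω : Euc N} (h : IsConeDir θ r Ω x ω) (hx : x ∈ closure Ω) {t : ℝ} (ht : 0 < t)
    (hts : t ≤ s) (hsr : 2 * s ≤ r) :
    |dirDeriv ω f (x + s • ω) - dirDeriv ω f (x + t • ω)| ≤
      D * Real.sin θ ^ (-((N : ℝ) + 1) / 2) * (2 / ((N : ℝ) - 1)) *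
        t ^ (-((N : ℝ) - 1) / 2) := by
  have hs0 : 0 < Real.sin θ :=
    Real.sin_pos_of_pos_of_lt_pi hθ.1 (by linarith [hθ.2, Real.pi_pos])
  have hr : 0 < r := by linarith
  have hN1 : (0 : ℝ) < (N : ℝ) - 1 := by
    have : (2 : ℝ) ≤ N := by exact_mod_cast hN
    linarith
  have hball : ∀ τ, 0 < τ → τ ≤ s → ball (x + τ • ω) (τ * Real.sin θ) ⊆ Ω := fun τ h0 h1 =>
    h.ball_subset hθ hx (by simpa using hr) h0 (by linarith)
  have hmem : ∀ τ, 0 < τ → τ ≤ s → x + τ • ω ∈ Ω := fun τ h0 h1 =>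
    hball τ h0 h1 (mem_ball_self (by positivity))
  set c := D * Real.sin θ ^ (-((N : ℝ) + 1) / 2) * (2 / ((N : ℝ) - 1)) with hc
  have hc0 : 0 ≤ c := by positivity
  have hder : ∀ τ, 0 < τ → τ ≤ s → HasDerivAt (fun τ : ℝ => dirDeriv ω f (x + τ • ω))
      (dirDeriv ω (dirDeriv ω f) (x + τ • ω)) τ := fun τ h0 h1 =>
    hasDerivAt_comp_add_smul (f := dirDeriv ω f)
      (differentiableAt_dirDeriv hΩ hf ω (hmem τ h0 h1))
  have := abs_sub_le_of_abs_deriv_le (φ := fun τ : ℝ => dirDeriv ω f (x + τ • ω))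
    (φ' := fun τ => dirDeriv ω (dirDeriv ω f) (x + τ • ω))
    (ψ := fun τ => -c * τ ^ (-((N : ℝ) - 1) / 2))
    (ψ' := fun τ => -c * ((-((N : ℝ) - 1) / 2) * τ ^ (-((N : ℝ) - 1) / 2 - 1))) hts
    (fun τ hτ => (hder τ (ht.trans_le hτ.1) hτ.2).continuousAt.continuousWithinAt)
    (continuousOn_const.mul (continuousOn_id.rpow_const fun τ hτ =>
      Or.inl (ht.trans_le hτ.1).ne'))
    (fun τ hτ => hder τ (ht.trans hτ.1) hτ.2.le)
    (fun τ hτ => (Real.hasDerivAt_rpow_const (Or.inl (ht.trans hτ.1).ne')).const_mul _)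
    fun τ hτ => by
      have hτ0 := ht.trans hτ.1
      refine (hH (by positivity) (hball τ hτ0 hτ.2.le) ω ω).trans_eq ?_
      rw [h.1, Real.mul_rpow hτ0.le hs0.le, hc,
        show -((N : ℝ) - 1) / 2 - 1 = -((N : ℝ) + 1) / 2 by ring]
      field_simp
  have hs' : 0 ≤ c * s ^ (-((N : ℝ) - 1) / 2) :=
    mul_nonneg hc0 (Real.rpow_nonneg (ht.le.trans hts) _)
  linarith

end BoundaryEstimate

/-- On the boundary, a harmonic function is close to an affine function. -/
lemma exists_boundary_bound (N : ℕ) (hN : 2 ≤ N) {θ a d : ℝ} (hθ : θ ∈ Ioc (0 : ℝ) (π / 2))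
    (ha : 0 < a) (hd : 0 < d) :
    ∃ K > (0 : ℝ), ∀ {Ω : Set (Euc N)}, IsOpen Ω → IsConnected Ω → Bornology.IsBounded Ω →
      Metric.diam Ω ≤ d → UnifConeCond θ a Ω → (frontier Ω).Nonempty →
      ∀ {h : Euc N → ℝ}, ContinuousOn h (closure Ω) → ContDiffOn ℝ 2 h Ω →
      (∀ x ∈ Ω, lap h x = 0) →
      IntegrableOn (fun x => infDist x (frontier Ω) * hessNormSq h x) Ω →
      ∀ {B M : ℝ}, B = √(∫ x in Ω, infDist x (frontier Ω) * hessNormSq h x) →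
      (∀ x ∈ Ω, ‖fderiv ℝ h x‖ ≤ M) →
      ∃ (Λ : Euc N →L[ℝ] ℝ) (c : ℝ), ∀ x ∈ frontier Ω,
        |h x - Λ x - c| ≤ K * stabRate N M B := by
  have hs0 : 0 < Real.sin θ :=
    Real.sin_pos_of_pos_of_lt_pi hθ.1 (by linarith [hθ.2, Real.pi_pos])
  have hN1 : (0 : ℝ) < (N : ℝ) - 1 := by
    have : (2 : ℝ) ≤ N := by exact_mod_cast hN
    linarith
  obtain ⟨A, hA, hess⟩ := exists_hess_bound N
  set s := a / 16 with hs
  have hspos : 0 < s := by positivity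
  obtain ⟨K₁, hK₁, osc₁⟩ := exists_osc_bound N hN hθ ha hd (show 0 < s / 2 by positivity)
    (by linarith)
  obtain ⟨K₂, hK₂, osc₂⟩ := exists_osc_bound N hN hθ ha hd hspos (by linarith)
  set ρ := s / 2 * Real.sin θ with hρ
  have hρpos : 0 < ρ := by positivity
  set E := K₁ * (A * (ρ / 2) ^ (-((N : ℝ) + 1) / 2)) with hE
  have hEpos : 0 < E := by positivity
  set C := A * Real.sin θ ^ (-((N : ℝ) + 1) / 2) * (2 / ((N : ℝ) - 1)) +
    E * s ^ (((N : ℝ) - 1) / 2) with hC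
  obtain ⟨K₃, hK₃, bdry⟩ := abs_sub_le_stabRate hN hspos (show 0 ≤ C by positivity)
  refine ⟨K₃ + K₂ * (2 + E), by positivity, ?_⟩
  intro Ω hΩ hΩc hΩb hdiam hcone hfr h hhc hh2 hlap hint B M hB hM
  have hB0 : 0 ≤ B := hB ▸ Real.sqrt_nonneg _
  have hM0 : 0 ≤ M := (norm_nonneg _).trans (hM _ hΩc.nonempty.some_mem)
  have hH : ∀ {x : Euc N} {r : ℝ}, 0 < r → ball x r ⊆ Ω → ∀ v w : Euc N,
      |dirDeriv w (dirDeriv v h) x| ≤ A * B * r ^ (-((N : ℝ) + 1) / 2) * ‖v‖ * ‖w‖ :=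
    fun hr hb v w => hess hΩ hfr hh2 hlap hint hB hr hb v w
  have hdiff : ∀ x ∈ Ω, DifferentiableAt ℝ h x :=
    fun x hx => differentiableAt_of_contDiffOn two_ne_zero hΩ hh2 hx
  have hcore : ∀ p q, ball p ρ ⊆ Ω → ball q ρ ⊆ Ω →
      ‖fderiv ℝ h p - fderiv ℝ h q‖ ≤ E * B := by
    intro p q hp hq
    refine ContinuousLinearMap.opNorm_le_bound _ (by positivity) fun v => ?_
    have := osc₁ Ω hΩc hΩb hdiam hcone (dirDeriv v h)
      (A * B * (ρ / 2) ^ (-((N : ℝ) + 1) / 2) * ‖v‖) (by positivity)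
      (lipAtDepth_dirDeriv hΩ hh2 (by positivity) hH (by positivity) v) p q hp hq
    refine this.trans_eq ?_
    rw [hE]; ring
  have hdir : ∀ x ∈ frontier Ω, ∃ ω, IsConeDir θ a Ω x ω := fun x hx => by
    obtain ⟨ω, hω, H⟩ := hcone x hx
    exact ⟨ω, hω, fun w' hw' hd => H w' ⟨hd, hw'⟩⟩
  have hpush : ∀ {x ω}, x ∈ frontier Ω → IsConeDir θ a Ω x ω → ∀ {t}, 0 < t → t ≤ s →
      ball (x + t • ω) (t * Real.sin θ) ⊆ Ω := fun hx hω t ht hts =>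
    hω.ball_subset hθ (frontier_subset_closure hx) (by simpa using ha) ht (by linarith)
  obtain ⟨x₀, hx₀⟩ := hfr
  obtain ⟨ω₀, hω₀⟩ := hdir x₀ hx₀
  set p₀ := x₀ + s • ω₀
  have hp₀ : ball p₀ (s * Real.sin θ) ⊆ Ω := hpush hx₀ hω₀ hspos le_rfl
  have hρs : ρ ≤ s * Real.sin θ := by rw [hρ]; nlinarith
  have hp₀Ω : p₀ ∈ Ω := hp₀ (mem_ball_self (by positivity))
  set Λ := fderiv ℝ h p₀
  set k : Euc N → ℝ := fun x => h x - Λ x with hk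
  have hkder : ∀ x ∈ Ω, HasFDerivAt k (fderiv ℝ h x - Λ) x := fun x hx =>
    (hdiff x hx).hasFDerivAt.sub Λ.hasFDerivAt
  have hk2M : ∀ x ∈ Ω, ‖fderiv ℝ h x - Λ‖ ≤ 2 * M := fun x hx =>
    (norm_sub_le _ _).trans (by linarith [hM x hx, hM p₀ hp₀Ω])
  have hR := min_le_stabRate hN hM0 hB0
  have hkcore : ∀ p, ball p (s * Real.sin θ) ⊆ Ω →
      |k p - k p₀| ≤ K₂ * (2 + E) * stabRate N M B := by
    intro p hp
    have := osc₂ Ω hΩc hΩb hdiam hcone k (min (2 * M) (E * B)) (by positivity)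
      (lipAtDepth_of_norm_fderiv_le
        (fun x hx => (hkder x (hx (mem_ball_self (by positivity)))).differentiableAt)
        fun x hx => by
          have hxΩ := hx (mem_ball_self (by positivity))
          rw [(hkder x hxΩ).fderiv]
          refine le_min (hk2M x hxΩ) (hcore x p₀ ?_ ((ball_subset_ball hρs).trans hp₀))
          rwa [hρ, div_mul_eq_mul_div]) p p₀ hp hp₀
    refine this.trans ?_
    rw [mul_assoc K₂]
    refine mul_le_mul_of_nonneg_left ?_ hK₂.le
    refine le_trans ?_ (mul_le_mul_of_nonneg_left hR (by positivity))
    rcases le_total M B with hMB | hMB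
    · rw [min_eq_left hMB]
      refine (min_le_left _ _).trans ?_
      nlinarith
    · rw [min_eq_right hMB]
      refine (min_le_right _ _).trans ?_
      nlinarith
  refine ⟨Λ, k p₀, fun x hx => ?_⟩
  obtain ⟨ω, hω⟩ := hdir x hx
  have hmem : ∀ t, 0 < t → t ≤ s → x + t • ω ∈ Ω := fun t ht hts =>
    hpush hx hω ht hts (mem_ball_self (by positivity))
  have hps := hpush hx hω hspos le_rfl
  have hkey := bdry hM0 hB0 (φ := fun t : ℝ => k (x + t • ω))
    (φ' := fun t => (fderiv ℝ h (x + t • ω) - Λ) ω) ?_ ?_ ?_ ?_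
  · simp only [zero_smul, add_zero] at hkey
    have h1 := hkcore _ hps
    have h2 := abs_sub_le (k x) (k (x + s • ω)) (k p₀)
    rw [abs_sub_comm (k x) (k (x + s • ω))] at h2
    change |k x - k p₀| ≤ _
    linarith
  · have hkc : ContinuousOn k (closure Ω) := hhc.sub Λ.continuous.continuousOn
    refine hkc.comp (by fun_prop) fun t ht => ?_
    rcases ht.1.eq_or_lt with rfl | h0
    · simpa using frontier_subset_closure hx
    · exact subset_closure (hmem t h0 ht.2)
  · intro t ht
    have hd := hkder _ (hmem t ht.1 ht.2.le)
    refine (hasDerivAt_comp_add_smul hd.differentiableAt).congr_deriv ?_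
    rw [dirDeriv, hd.fderiv]
  · intro t ht
    rw [← Real.norm_eq_abs]
    refine (ContinuousLinearMap.le_opNorm _ _).trans ?_
    rw [hω.1, mul_one]
    exact hk2M _ (hmem t ht.1 ht.2.le)
  · intro t ht
    have h1 := hω.abs_dirDeriv_sub_le hN hθ hΩ hh2 (by positivity) hH
      (frontier_subset_closure hx) ht.1 ht.2.le (by linarith)
    have h2 : |(fderiv ℝ h (x + s • ω) - Λ) ω| ≤ E * B := by
      rw [← Real.norm_eq_abs]
      refine (ContinuousLinearMap.le_opNorm _ _).trans ?_
      rw [hω.1, mul_one]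
      exact hcore _ _ ((ball_subset_ball hρs).trans hps) ((ball_subset_ball hρs).trans hp₀)
    have h3 : |(fderiv ℝ h (x + t • ω) - Λ) ω| ≤
        |dirDeriv ω h (x + s • ω) - dirDeriv ω h (x + t • ω)| +
          |(fderiv ℝ h (x + s • ω) - Λ) ω| := by
      have := abs_sub_le ((fderiv ℝ h (x + t • ω) - Λ) ω) ((fderiv ℝ h (x + s • ω) - Λ) ω) 0
      rw [sub_zero, sub_zero, abs_sub_comm] at this
      refine this.trans_eq ?_
      congr 2
      simp [dirDeriv]
    have h4 : 1 ≤ s ^ (((N : ℝ) - 1) / 2) * t ^ (-((N : ℝ) - 1) / 2) := by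
      rw [neg_div, Real.rpow_neg ht.1.le, ← div_eq_mul_inv, one_le_div (Real.rpow_pos_of_pos ht.1 _)]
      exact Real.rpow_le_rpow ht.1.le ht.2.le (by positivity)
    have h5 : E * B ≤ E * B * (s ^ (((N : ℝ) - 1) / 2) * t ^ (-((N : ℝ) - 1) / 2)) :=
      le_mul_of_one_le_right (by positivity) h4
    refine (h3.trans (add_le_add h1 (h2.trans h5))).trans_eq ?_
    rw [hC]; ring

section Geometry

variable {N : ℕ} {Ω : Set (Euc N)}

lemma dist_add_half_le_of_ball_subset_closedBall (hN : 2 ≤ N) {p c : Euc N} {σ R : ℝ}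
    (hσ : 0 < σ) (h : ball p σ ⊆ closedBall c R) : dist p c + σ / 2 ≤ R := by
  obtain ⟨e, he, hpe⟩ : ∃ e : Euc N, ‖e‖ = 1 ∧ p - c = ‖p - c‖ • e := by
    rcases eq_or_ne (p - c) 0 with h0 | h0
    · exact ⟨EuclideanSpace.single ⟨0, by omega⟩ 1, by simp, by simp [h0]⟩
    · have hne : ‖p - c‖ ≠ 0 := norm_ne_zero_iff.2 h0
      refine ⟨‖p - c‖⁻¹ • (p - c), by simp [norm_smul, hne], ?_⟩
      rw [smul_smul, mul_inv_cancel₀ hne, one_smul]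
  have hmem : p + (σ / 2) • e ∈ ball p σ := by
    rw [mem_ball, dist_comm, dist_add_smul_self he (by positivity)]
    linarith
  have h1 := mem_closedBall.1 (h hmem)
  have e1 : p + (σ / 2) • e - c = (‖p - c‖ + σ / 2) • e := by
    rw [add_smul, ← hpe]; abel
  rwa [dist_eq_norm, e1, norm_smul, he, mul_one, Real.norm_of_nonneg (by positivity),
    ← dist_eq_norm] at h1

/-- A bounded open set lies in every closed ball containing its boundary. -/
lemma subset_closedBall_of_frontier_subset (hΩ : IsOpen Ω) (hΩb : Bornology.IsBounded Ω)
    {c : Euc N} {R : ℝ} (hR : 0 ≤ R) (h : frontier Ω ⊆ closedBall c R) : Ω ⊆ closedBall c R := by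
  rcases Ω.eq_empty_or_nonempty with rfl | hne
  · exact empty_subset _
  obtain ⟨y, hy, hmax⟩ := (hΩb.isCompact_closure).exists_isMaxOn hne.closure
    (continuous_id.dist continuous_const).continuousOn (f := fun x => dist x c)
  suffices hyR : dist y c ≤ R from fun x hx => (hmax (subset_closure hx)).trans hyR
  by_contra hyR
  push Not at hyR
  have hyΩ : y ∈ Ω := by
    by_contra hn
    exact absurd (h (by rw [hΩ.frontier_eq]; exact ⟨hy, hn⟩)) (by simpa using hyR)
  have hcont : Continuous fun ε : ℝ => y + ε • (y - c) := by fun_prop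
  have hev : ∀ᶠ ε in nhdsWithin (0 : ℝ) (Ioi 0), y + ε • (y - c) ∈ Ω :=
    (hcont.continuousAt.eventually_mem (hΩ.mem_nhds (by simpa using hyΩ))).filter_mono
      nhdsWithin_le_nhds
  obtain ⟨ε, hεΩ, hε⟩ := (hev.and self_mem_nhdsWithin).exists
  have h1 : dist (y + ε • (y - c)) c ≤ dist y c := hmax (subset_closure hεΩ)
  have e1 : y + ε • (y - c) - c = (1 + ε) • (y - c) := by
    rw [add_smul, one_smul]; abel
  have hε' : (0 : ℝ) < ε := hε
  rw [dist_eq_norm, e1, norm_smul, Real.norm_of_nonneg (by positivity), ← dist_eq_norm] at h1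
  nlinarith

lemma integral_ball_sub_center (c : Euc N) (r : ℝ) : ∫ x in ball c r, (x - c) = 0 := by
  set f : Euc N → Euc N := (ball (0 : Euc N) r).indicator id with hf
  have h1 : ∫ x in ball c r, (x - c) = ∫ x, f (x - c) := by
    rw [← integral_indicator measurableSet_ball]
    congr 1
    ext1 x
    simp [hf, indicator, dist_eq_norm]
  have h2 : ∫ x, f (-x) = ∫ x, f x := integral_neg_eq_self f volume
  have h3 : ∀ x, f (-x) = -f x := fun x => by simp [hf, indicator]; split_ifs <;> simp
  simp only [h3, integral_neg] at h2
  rw [h1, integral_sub_right_eq_self]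
  have h4 : (2 : ℝ) • ∫ x, f x = 0 := by
    rw [two_smul]
    nth_rewrite 1 [← h2]
    exact neg_add_cancel _
  exact (smul_eq_zero.1 h4).resolve_left two_ne_zero

/-- The barycenter of a set between two concentric balls is close to their center. -/
lemma norm_barycenter_sub_le (hN : 2 ≤ N) {c p z : Euc N} {r R σ : ℝ}
    (hσ : 0 < σ) (hp : ball p σ ⊆ Ω) (hr : 0 ≤ r) (hrR : r ≤ R) (hrΩ : ball c r ⊆ Ω)
    (hRΩ : Ω ⊆ closedBall c R) (hz : z = ⨍ x in Ω, x) :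
    σ ^ N * ‖z - c‖ ≤ N * R ^ N * (R - r) := by
  have hR : 0 ≤ R := hr.trans hrR
  have hfin : volume Ω ≠ ⊤ := (measure_lt_top_of_subset hRΩ measure_closedBall_lt_top.ne).ne
  set ω := volume.real (ball (0 : Euc N) 1) with hω
  have hω0 : 0 < ω := by
    rw [hω, measureReal_def]
    exact ENNReal.toReal_pos (measure_ball_pos _ _ one_pos).ne' measure_ball_lt_top.ne
  have hfr : Module.finrank ℝ (Euc N) = N := finrank_euclideanSpace_fin
  have : Nontrivial (Euc N) := Module.nontrivial_of_finrank_pos (R := ℝ) (by omega)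
  have hball : ∀ (q : Euc N) {ρ : ℝ}, 0 ≤ ρ → volume.real (ball q ρ) = ρ ^ N * ω := by
    intro q ρ hρ
    rw [hω, measureReal_def, Measure.addHaar_ball volume q hρ, hfr, ENNReal.toReal_mul,
      ENNReal.toReal_ofReal (by positivity), measureReal_def]
  have hvol : σ ^ N * ω ≤ volume.real Ω := hball p hσ.le ▸ measureReal_mono hp hfin
  have hvol2 : volume.real (Ω \ ball c r) ≤ (R ^ N - r ^ N) * ω := by
    have h1 := measureReal_mono hRΩ (μ := volume) measure_closedBall_lt_top.ne
    rw [Measure.addHaar_real_closedBall volume c hR, hfr] at h1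
    rw [measureReal_sdiff hrΩ measurableSet_ball hfin, hball c hr]
    linarith
  have hint : IntegrableOn (fun x : Euc N => x) Ω :=
    (continuousOn_id.integrableOn_compact (isCompact_closedBall c R)).mono_set hRΩ
  have hint' : IntegrableOn (fun x : Euc N => x - c) Ω := hint.sub (integrableOn_const hfin)
  have h1 : volume.real Ω • (z - c) = ∫ x in Ω, (x - c) := by
    rw [integral_sub hint (integrableOn_const hfin), setIntegral_const, smul_sub, hz,
      measure_smul_setAverage _ hfin]
  have h2 : ∫ x in Ω, (x - c) = ∫ x in Ω \ ball c r, (x - c) := by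
    rw [setIntegral_sdiff measurableSet_ball hint' hrΩ, integral_ball_sub_center, sub_zero]
  have h3 : ‖∫ x in Ω \ ball c r, (x - c)‖ ≤ R * volume.real (Ω \ ball c r) := by
    refine norm_setIntegral_le_of_norm_le_const
      (measure_lt_top_of_subset sdiff_subset hfin) fun x hx => ?_
    rw [← dist_eq_norm]
    exact hRΩ hx.1
  rw [← h2, ← h1, norm_smul, Real.norm_of_nonneg measureReal_nonneg] at h3
  have h4 : R ^ N - r ^ N ≤ N * R ^ (N - 1) * (R - r) := by
    have := abs_pow_sub_pow_le R r N
    rw [abs_of_nonneg (sub_nonneg.2 hrR), abs_of_nonneg hR, abs_of_nonneg hr,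
      max_eq_left hrR] at this
    linarith [le_abs_self (R ^ N - r ^ N)]
  have h5 : ω * (σ ^ N * ‖z - c‖) ≤ ω * (N * R ^ N * (R - r)) := by
    calc ω * (σ ^ N * ‖z - c‖) = σ ^ N * ω * ‖z - c‖ := by ring
      _ ≤ volume.real Ω * ‖z - c‖ := by gcongr
      _ ≤ R * volume.real (Ω \ ball c r) := h3
      _ ≤ R * ((N * R ^ (N - 1) * (R - r)) * ω) := by
        gcongr
        exact hvol2.trans (by gcongr)
      _ = ω * (N * (R ^ (N - 1) * R) * (R - r)) := by ring
      _ = ω * (N * R ^ N * (R - r)) := by rw [pow_sub_one_mul (by omega)]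
  exact le_of_mul_le_mul_left h5 hω0

/-- If the boundary nearly lies on a sphere with some center, then it nearly lies on a sphere
centered at the barycenter. -/
lemma dist_sub_dist_le_of_nearly_spherical (hN : 2 ≤ N) (hΩ : IsOpen Ω)
    (hΩb : Bornology.IsBounded Ω) {d : ℝ} (hdiam : Metric.diam Ω ≤ d) {p c z : Euc N} {σ : ℝ}
    (hσ : 0 < σ) (hp : ball p σ ⊆ Ω) (hz : z = ⨍ x in Ω, x) {κ Ψ : ℝ}
    (hΨ : ∀ x ∈ frontier Ω, |‖x - c‖ ^ 2 / 2 - κ| ≤ Ψ) {x y : Euc N} (hx : x ∈ frontier Ω)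
    (hy : y ∈ frontier Ω) :
    dist x z - dist y z ≤ 8 / σ * (2 * d / σ + 1 + 2 * N * d ^ N / σ ^ N) * Ψ := by
  have hd : 0 ≤ d := Metric.diam_nonneg.trans hdiam
  have hclosure : ∀ x ∈ closure Ω, ∀ y ∈ closure Ω, dist x y ≤ d := fun x hx y hy =>
    (dist_le_diam_of_mem hΩb.closure hx hy).trans ((Metric.diam_closure Ω).trans_le hdiam)
  have hfcl : frontier Ω ⊆ closure Ω := frontier_subset_closure
  have hcomp : IsCompact (frontier Ω) :=
    hΩb.isCompact_closure.of_isClosed_subset isClosed_frontier hfcl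
  have hcont : ContinuousOn (fun x => dist x c) (frontier Ω) := by fun_prop
  obtain ⟨xe, hxe, hmax⟩ := hcomp.exists_isMaxOn ⟨x, hx⟩ hcont
  obtain ⟨xi, hxi, hmin⟩ := hcomp.exists_isMinOn ⟨x, hx⟩ hcont
  set R := dist xe c with hR
  set r := dist xi c with hr
  have hr0 : 0 ≤ r := dist_nonneg
  have hrR : r ≤ R := hmin hxe
  have hRΩ : Ω ⊆ closedBall c R :=
    subset_closedBall_of_frontier_subset hΩ hΩb dist_nonneg fun x hx => hmax hx
  have hpR := dist_add_half_le_of_ball_subset_closedBall hN hσ (hp.trans hRΩ)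
  have hpΩ := hp (mem_ball_self hσ)
  have hsq : R ^ 2 - r ^ 2 ≤ 4 * Ψ := by
    have h1 := (abs_le.1 (hΨ xe hxe)).2
    have h2 := (abs_le.1 (hΨ xi hxi)).1
    rw [← dist_eq_norm] at h1 h2
    linarith
  have hgap : R - r ≤ 8 / σ * Ψ := by
    rw [div_mul_eq_mul_div, le_div_iff₀ hσ]
    have : σ / 2 ≤ R + r := by linarith [dist_nonneg (x := p) (y := c)]
    nlinarith
  suffices h : dist x z - dist y z ≤ (2 * d / σ + 1 + 2 * N * d ^ N / σ ^ N) * (R - r) by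
    refine h.trans ?_
    rw [mul_comm (8 / σ), mul_assoc (2 * d / σ + 1 + 2 * N * d ^ N / σ ^ N)]
    exact mul_le_mul_of_nonneg_left hgap (by positivity)
  have hgap0 : 0 ≤ R - r := sub_nonneg.2 hrR
  have hdisj : ball c r ∩ frontier Ω = ∅ := by
    ext w
    simp only [mem_inter_iff, mem_ball, mem_empty_iff_false, iff_false, not_and]
    exact fun hw hwf => absurd hw (not_lt.2 (hmin hwf))
  by_cases hc : c ∈ Ω
  · have hrΩ : ball c r ⊆ Ω := by
      rcases hr0.eq_or_lt with h0 | h0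
      · rw [← h0, ball_zero]; exact empty_subset _
      · exact ball_subset_of_disjoint_frontier hc (mem_ball_self h0) hdisj
    have hbar := norm_barycenter_sub_le hN hσ hp hr0 hrR hrΩ hRΩ hz
    have hRd : R ≤ d := hclosure _ (hfcl hxe) _ (subset_closure hc)
    have hbar' : ‖z - c‖ ≤ N * d ^ N / σ ^ N * (R - r) := by
      rw [div_mul_eq_mul_div, le_div_iff₀ (by positivity), mul_comm]
      refine hbar.trans ?_
      gcongr
    rw [← dist_eq_norm] at hbar'
    have h1 := dist_triangle_right x z c
    have h2 := dist_triangle y z c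
    have h3 : dist x c ≤ R := hmax hx
    have h4 : r ≤ dist y c := hmin hy
    have h5 : 0 ≤ 2 * d / σ * (R - r) := by positivity
    have e1 : 2 * N * d ^ N / σ ^ N * (R - r) = 2 * (N * d ^ N / σ ^ N * (R - r)) := by ring
    rw [add_mul, add_mul, e1]
    linarith
  · have hpr : r ≤ dist p c := by
      by_contra hlt
      push Not at hlt
      exact hc (ball_subset_of_disjoint_frontier hpΩ hlt hdisj
        (mem_ball_self (dist_nonneg.trans_lt hlt)))
    have h1 := dist_triangle x y z
    have h2 := hclosure x (hfcl hx) y (hfcl hy)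
    have h3 : d ≤ 2 * d / σ * (R - r) := by
      rw [div_mul_eq_mul_div, le_div_iff₀ hσ]
      nlinarith
    have h4 : 0 ≤ (1 + 2 * N * d ^ N / σ ^ N) * (R - r) := by positivity
    nlinarith

end Geometry

section Torsion

variable {N : ℕ} {Ω : Set (Euc N)} {u : Euc N → ℝ} {z : Euc N}

lemma hasFDerivAt_half_norm_sub_sq (z x : Euc N) :
    HasFDerivAt (fun x => ‖x - z‖ ^ 2 / 2) (innerSL ℝ (x - z)) x := by
  have h1 := (((hasFDerivAt_id x).sub_const z).norm_sq).const_mul (1 / 2 : ℝ)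
  refine (h1.congr_fderiv ?_).congr_of_eventuallyEq (Filter.Eventually.of_forall fun y => ?_)
  · ext w
    simp
  · simp only [id]; ring

lemma hasFDerivAt_half_norm_sub_sq_sub (z : Euc N) {x : Euc N} (hu : DifferentiableAt ℝ u x) :
    HasFDerivAt (fun x => ‖x - z‖ ^ 2 / 2 - u x) (innerSL ℝ (x - z) - fderiv ℝ u x) x :=
  (hasFDerivAt_half_norm_sub_sq z x).sub hu.hasFDerivAt

lemma hessEntry_half_norm_sub_sq_sub (hΩ : IsOpen Ω) (hu : ContDiffOn ℝ 2 u Ω) {x : Euc N}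
    (hx : x ∈ Ω) (i j : Fin N) :
    hessEntry (fun x => ‖x - z‖ ^ 2 / 2 - u x) x i j =
      (if i = j then 1 else 0) - hessEntry u x i j := by
  set e : Fin N → Euc N := fun i => EuclideanSpace.single i (1 : ℝ)
  have h1 : (fun y => fderiv ℝ (fun x => ‖x - z‖ ^ 2 / 2 - u x) y (e j)) =ᶠ[nhds x]
      fun y => ⟪e j, y - z⟫ - dirDeriv (e j) u y := by
    filter_upwards [hΩ.mem_nhds hx] with y hy
    rw [(hasFDerivAt_half_norm_sub_sq_sub z
      (differentiableAt_of_contDiffOn two_ne_zero hΩ hu hy)).fderiv]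
    rw [sub_apply, innerSL_apply_apply, real_inner_comm, dirDeriv]
  have h2 : HasFDerivAt (fun y => ⟪e j, y - z⟫ - dirDeriv (e j) u y)
      (innerSL ℝ (e j) - fderiv ℝ (dirDeriv (e j) u) x) x := by
    refine HasFDerivAt.sub ?_ (differentiableAt_dirDeriv hΩ hu (e j) hx).hasFDerivAt
    exact (innerSL ℝ (e j)).hasFDerivAt.comp x ((hasFDerivAt_id x).sub_const z)
  rw [hessEntry, h1.fderiv_eq, h2.fderiv]
  change ⟪e j, e i⟫ - hessEntry u x i j = _
  simp [e, EuclideanSpace.inner_single_left, eq_comm]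

lemma hessNormSq_half_norm_sub_sq_sub_le (hΩ : IsOpen Ω) (hu : ContDiffOn ℝ 2 u Ω) {x : Euc N}
    (hx : x ∈ Ω) :
    hessNormSq (fun x => ‖x - z‖ ^ 2 / 2 - u x) x ≤ 2 * hessNormSq u x + 2 * N := by
  have h1 : ∀ i j, hessEntry (fun x => ‖x - z‖ ^ 2 / 2 - u x) x i j ^ 2 ≤
      2 * hessEntry u x i j ^ 2 + 2 * (if i = j then 1 else 0) := by
    intro i j
    rw [hessEntry_half_norm_sub_sq_sub hΩ hu hx]
    split_ifs <;> nlinarith [sq_nonneg (1 + hessEntry u x i j)]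
  refine (Finset.sum_le_sum fun i _ => Finset.sum_le_sum fun j _ => h1 i j).trans_eq ?_
  simp [hessNormSq, Finset.sum_add_distrib, Finset.mul_sum, mul_comm]

lemma lap_half_norm_sub_sq_sub (hΩ : IsOpen Ω) (hu : ContDiffOn ℝ 2 u Ω) {x : Euc N}
    (hx : x ∈ Ω) : lap (fun x => ‖x - z‖ ^ 2 / 2 - u x) x = N - lap u x := by
  simp [lap, hessEntry_half_norm_sub_sq_sub hΩ hu hx]

lemma contDiffOn_half_norm_sub_sq_sub (hu : ContDiffOn ℝ 2 u Ω) :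
    ContDiffOn ℝ 2 (fun x => ‖x - z‖ ^ 2 / 2 - u x) Ω :=
  (((contDiff_id.sub contDiff_const).norm_sq ℝ).div_const 2).contDiffOn.sub hu

lemma infDist_frontier_le_diam (hΩb : Bornology.IsBounded Ω) (hfr : (frontier Ω).Nonempty)
    {x : Euc N} (hx : x ∈ Ω) : infDist x (frontier Ω) ≤ Metric.diam Ω := by
  obtain ⟨y, hy⟩ := hfr
  refine (infDist_le_dist_of_mem hy).trans ?_
  rw [← Metric.diam_closure]
  exact dist_le_diam_of_mem hΩb.closure (subset_closure hx) (frontier_subset_closure hy)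

lemma integrableOn_infDist_mul_hessNormSq (hΩ : IsOpen Ω) (hΩb : Bornology.IsBounded Ω)
    (hfr : (frontier Ω).Nonempty) (hu : ContDiffOn ℝ 2 u Ω)
    (hint : IntegrableOn (fun x => hessNormSq u x) Ω) :
    IntegrableOn (fun x => infDist x (frontier Ω) *
      hessNormSq (fun x => ‖x - z‖ ^ 2 / 2 - u x) x) Ω := by
  have hdom : IntegrableOn (fun x => Metric.diam Ω * (2 * hessNormSq u x + 2 * N)) Ω :=
    ((hint.const_mul 2).add (integrableOn_const hΩb.measure_lt_top.ne)).const_mul _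
  refine Integrable.mono' hdom ?_ ?_
  · exact ((continuous_infDist_pt _).continuousOn.mul (continuousOn_hessNormSq hΩ
      (contDiffOn_half_norm_sub_sq_sub hu))).aestronglyMeasurable hΩ.measurableSet
  · refine (ae_restrict_iff' hΩ.measurableSet).2 (Filter.Eventually.of_forall fun x hx => ?_)
    rw [Real.norm_of_nonneg (mul_nonneg infDist_nonneg (hessNormSq_nonneg _ _))]
    exact mul_le_mul (infDist_frontier_le_diam hΩb hfr hx)
      (hessNormSq_half_norm_sub_sq_sub_le hΩ hu hx) (hessNormSq_nonneg _ _) Metric.diam_nonneg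

lemma norm_gradient (f : Euc N → ℝ) (x : Euc N) : ‖gradient f x‖ = ‖fderiv ℝ f x‖ :=
  LinearIsometryEquiv.norm_map _ _

lemma bddAbove_norm_gradient (hΩ : IsOpen Ω) (hΩb : Bornology.IsBounded Ω)
    (hu : ContDiffOn ℝ 2 u Ω) {g : Euc N → Euc N} (hg : ContinuousOn g (closure Ω))
    (hgu : ∀ x ∈ Ω, g x = gradient u x) :
    BddAbove ((fun x => ‖gradient (fun x => ‖x - z‖ ^ 2 / 2 - u x) x‖) '' Ω) := by
  obtain ⟨K₁, hK₁⟩ := hΩb.isCompact_closure.exists_bound_of_continuousOn hg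
  obtain ⟨K₂, hK₂⟩ := hΩb.isCompact_closure.exists_bound_of_continuousOn
    (f := fun x => x - z) (by fun_prop)
  refine ⟨K₂ + K₁, ?_⟩
  rintro _ ⟨x, hx, rfl⟩
  have h1 := hK₁ x (subset_closure hx)
  rw [hgu x hx, norm_gradient] at h1
  have h2 := hK₂ x (subset_closure hx)
  simp only
  rw [norm_gradient, (hasFDerivAt_half_norm_sub_sq_sub z
    (differentiableAt_of_contDiffOn two_ne_zero hΩ hu hx)).fderiv]
  refine (norm_sub_le _ _).trans (add_le_add ?_ h1)
  rwa [innerSL_apply_norm]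

/-- Completing the square. -/
lemma exists_center_half_norm_sub_sq_sub (Λ : Euc N →L[ℝ] ℝ) (z : Euc N) :
    ∃ (c : Euc N) (κ : ℝ), ∀ x, ‖x - z‖ ^ 2 / 2 - Λ x = ‖x - c‖ ^ 2 / 2 - κ := by
  set l := (InnerProductSpace.toDual ℝ (Euc N)).symm Λ
  refine ⟨z + l, ⟪z, l⟫ + ‖l‖ ^ 2 / 2, fun x => ?_⟩
  have h1 : Λ x = ⟪l, x⟫ := (InnerProductSpace.toDual_symm_apply).symm
  rw [h1, ← sub_sub x z l, norm_sub_sq_real (x - z) l, inner_sub_left, real_inner_comm]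
  ring

end Torsion

lemma sSup_sub_sInf_image_le {α : Type*} [TopologicalSpace α] {S : Set α} (hS : IsCompact S)
    (hne : S.Nonempty) {f : α → ℝ} (hf : ContinuousOn f S) {C : ℝ}
    (h : ∀ x ∈ S, ∀ y ∈ S, f x - f y ≤ C) : sSup (f '' S) - sInf (f '' S) ≤ C := by
  obtain ⟨x, hx, hx'⟩ := (hS.image_of_continuousOn hf).sSup_mem (hne.image f)
  obtain ⟨y, hy, hy'⟩ := (hS.image_of_continuousOn hf).sInf_mem (hne.image f)
  rw [← hx', ← hy']
  exact h x hx y hy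

/-- improved bound for `ρ_e - ρ_i` in terms of the weighted `L²` norm of `∇²h`
(weight `dist(x,∂Ω)`). -/
theorem stmt_15 (N : ℕ) (hN : 2 ≤ N) (θ a d : ℝ) (hθ : θ ∈ Ioc (0:ℝ) (π / 2))
    (ha : 0 < a) (hd : 0 < d) :
    ∃ C > (0:ℝ), ∀ Ω : Set (Euc N), IsOpen Ω → IsConnected Ω → Bornology.IsBounded Ω →
      Metric.diam Ω ≤ d → UnifConeCond θ a Ω →
      ∀ u : Euc N → ℝ, IsTorsion Ω u →
      ∀ g : Euc N → Euc N, ContinuousOn g (closure Ω) → (∀ x ∈ Ω, g x = gradient u x) →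
      IntegrableOn (fun x => hessNormSq u x) Ω volume →
      ∀ z : Euc N, z = (⨍ x in Ω, x) →
      ∀ h : Euc N → ℝ, h = (fun x => ‖x - z‖ ^ 2 / 2 - u x) →
      ∀ ρe ρi B M : ℝ,
        ρe = sSup ((fun x => dist x z) '' frontier Ω) →
        ρi = sInf ((fun x => dist x z) '' frontier Ω) →
        B = Real.sqrt (∫ x in Ω, infDist x (frontier Ω) * hessNormSq h x) →
        M = sSup ((fun x => ‖gradient h x‖) '' Ω) →
        ((N = 2 → ρe - ρi ≤ C * B) ∧
         (N = 3 → ρe - ρi ≤ C * (B * max (Real.log (Real.exp 1 * M / B)) 1)) ∧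
         (4 ≤ N → ρe - ρi ≤ C * (M ^ (((N:ℝ) - 3) / ((N:ℝ) - 1)) * B ^ ((2:ℝ) / ((N:ℝ) - 1))))) := by
  have hs0 : 0 < Real.sin θ :=
    Real.sin_pos_of_pos_of_lt_pi hθ.1 (by linarith [hθ.2, Real.pi_pos])
  obtain ⟨K, hK, bdry⟩ := exists_boundary_bound N hN hθ ha hd
  set σ := a / 2 * Real.sin θ with hσ
  have hσ0 : 0 < σ := by positivity
  set G := 8 / σ * (2 * d / σ + 1 + 2 * N * d ^ N / σ ^ N) with hG
  have hG0 : 0 < G := by positivity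
  refine ⟨G * K, by positivity, ?_⟩
  intro Ω hΩ hΩc hΩb hdiam hcone u hu g hg hgu hint z hz h hh ρe ρi B M hρe hρi hB hM
  obtain ⟨huc, hu2, hulap, hu0⟩ := hu
  have hNpos : Nontrivial (Euc N) :=
    Module.nontrivial_of_finrank_pos (R := ℝ) (by rw [finrank_euclideanSpace_fin]; omega)
  have hfr : (frontier Ω).Nonempty := by
    refine nonempty_frontier_iff.2 ⟨hΩc.nonempty, ?_⟩
    rintro rfl
    exact NormedSpace.unbounded_univ ℝ (Euc N) hΩb
  have hbound : ∀ x ∈ Ω, ‖fderiv ℝ h x‖ ≤ M := by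
    intro x hx
    rw [hM, ← norm_gradient]
    have hbdd := bddAbove_norm_gradient (z := z) hΩ hΩb hu2 hg hgu
    rw [← hh] at hbdd
    exact le_csSup hbdd ⟨x, hx, rfl⟩
  have hhc : ContinuousOn h (closure Ω) := by
    rw [hh]
    exact ContinuousOn.sub (by fun_prop) huc
  obtain ⟨Λ, κ₁, hΛ⟩ := bdry hΩ hΩc hΩb hdiam hcone hfr hhc
    (hh ▸ contDiffOn_half_norm_sub_sq_sub hu2)
    (fun x hx => by rw [hh, lap_half_norm_sub_sq_sub hΩ hu2 hx, hulap x hx, sub_self])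
    (hh ▸ integrableOn_infDist_mul_hessNormSq hΩ hΩb hfr hu2 hint) hB hbound
  obtain ⟨c, κ₂, hc⟩ := exists_center_half_norm_sub_sq_sub Λ z
  have hΨ : ∀ x ∈ frontier Ω, |‖x - c‖ ^ 2 / 2 - (κ₂ + κ₁)| ≤ K * stabRate N M B := by
    intro x hx
    have h1 := hΛ x hx
    have h2 := hc x
    simp only [hh, hu0 x hx, sub_zero] at h1
    rwa [h2, sub_sub] at h1
  have hcomp : IsCompact (frontier Ω) :=
    hΩb.isCompact_closure.of_isClosed_subset isClosed_frontier frontier_subset_closure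
  have main : ρe - ρi ≤ G * K * stabRate N M B := by
    obtain ⟨x₀, hx₀⟩ := hfr
    obtain ⟨ω, hω, hcω⟩ := hcone x₀ hx₀
    have hdir : IsConeDir θ a Ω x₀ ω := ⟨hω, fun w hw hd => hcω w ⟨hd, hw⟩⟩
    have hball : ball (x₀ + (a / 2) • ω) σ ⊆ Ω :=
      hdir.ball_subset hθ (frontier_subset_closure hx₀) (by simpa using ha) (by positivity)
        (by linarith)
    rw [hρe, hρi, mul_assoc]
    exact sSup_sub_sInf_image_le hcomp ⟨x₀, hx₀⟩ (by fun_prop) fun x hx y hy =>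
      dist_sub_dist_le_of_nearly_spherical hN hΩ hΩb hdiam hσ0 hball hz hΨ hx hy
  refine ⟨fun h2 => ?_, fun h3 => ?_, fun h4 => ?_⟩
  · rwa [stabRate, if_pos h2] at main
  · rwa [stabRate, if_neg (by omega), if_pos h3] at main
  · rwa [stabRate, if_neg (by omega), if_neg (by omega)] at main
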